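/- arXiv:1107.1120 — 2 statements merged into one kernel-verified Lean document; each statement's English description precedes it below -/
import Mathlib

section
/- There is a group isomorphism from Gal(M_{p,2}/ℚ_p) onto the regular wreath product C_p ≀ C_d, i.e. onto the semidirect product (ℤ/dℤ → ℤ/pℤ) ⋊ ℤ/dℤ, where ℤ/dℤ acts on the group of functions ℤ/dℤ → ℤ/pℤ by translating the argument; such an isomorphism can be chosen to carry the subgroup Gal(M_{p,2}/K) onto the base group of functions ℤ/dℤ → ℤ/pℤ. -/
open Polynomial Filter IntermediateField

variable (p : ℕ) [Fact p.Prime]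

/-- A fixed algebraic closure of `ℚ_p`. -/
noncomputable abbrev Qpbar := AlgebraicClosure ℚ_[p]

/-- The unramified extension `K` of `ℚ_p` of degree `d` inside `ℚ̄_p`, realized as the
splitting field of `X^(p^d - 1) - 1`. -/
noncomputable def Kur (d : ℕ) : IntermediateField ℚ_[p] (Qpbar p) :=
  IntermediateField.adjoin ℚ_[p] {x : Qpbar p | x ^ (p ^ d - 1) = 1}

/-- `M_{p,2}`: the splitting field over `K`, inside `ℚ̄_p`, of `X (X+p)^{q-1} + p`
(`q = p^d`), viewed as an extension of `ℚ_p`. -/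
noncomputable def Mp2 (d : ℕ) : IntermediateField ℚ_[p] (Qpbar p) :=
  (IntermediateField.adjoin (Kur p d)
    {x : Qpbar p | (X * (X + C (p : Qpbar p)) ^ (p ^ d - 1) + C (p : Qpbar p) :
      Polynomial (Qpbar p)).IsRoot x}).restrictScalars ℚ_[p]

/-- Translation of the argument by `s : ℤ/dℤ` on functions `ℤ/dℤ → ℤ/pℤ`. -/
def shiftEquiv (d q : ℕ) (s : ZMod d) : (ZMod d → ZMod q) ≃+ (ZMod d → ZMod q) where
  toFun f := fun i => f (i + s)
  invFun f := fun i => f (i - s)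
  left_inv f := by funext i; simp
  right_inv f := by funext i; simp
  map_add' f g := rfl

/-- The action of `C_d = ℤ/dℤ` on the base group `ℤ/dℤ → ℤ/pℤ` of the regular wreath
product, by translation of the argument. -/
def shiftHom (d q : ℕ) : Multiplicative (ZMod d) →* MulAut (Multiplicative (ZMod d → ZMod q)) where
  toFun s := AddEquiv.toMultiplicative (shiftEquiv d q s.toAdd)
  map_one' := by
    apply MulEquiv.ext
    intro f
    apply _root_.funext
    intro i
    exact congrArg (Multiplicative.toAdd f) (add_zero i)
  map_mul' a b := by
    apply MulEquiv.ext
    intro f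
    apply _root_.funext
    intro i
    exact congrArg (Multiplicative.toAdd f)
      (add_assoc i (Multiplicative.toAdd a) (Multiplicative.toAdd b)).symm

/-- The regular wreath product `C_q ≀ C_d = (ℤ/dℤ → ℤ/qℤ) ⋊ ℤ/dℤ`. -/
abbrev Wreath (d q : ℕ) :=
  SemidirectProduct (Multiplicative (ZMod d → ZMod q)) (Multiplicative (ZMod d)) (shiftHom d q)

/-- The subgroup `Gal(M_{p,2}/K)` of `Gal(M_{p,2}/ℚ_p)`, i.e. the automorphisms fixing `K`
pointwise. -/
def fixKur (d : ℕ) : Subgroup (Mp2 p d ≃ₐ[ℚ_[p]] Mp2 p d) where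
  carrier := {g | ∀ x : Mp2 p d, (x : Qpbar p) ∈ Kur p d → g x = x}
  one_mem' := fun _ _ => rfl
  mul_mem' := by
    intro a b ha hb x hx
    show a (b x) = x
    rw [hb x hx, ha x hx]
  inv_mem' := by
    intro a ha x hx
    have h1 : a.symm (a x) = x := a.symm_apply_apply x
    rw [ha x hx] at h1
    exact h1

section GroupPart

theorem exists_wreath_equiv {d : ℕ} (hd : 0 < d) (F : Type*) [Field F] [Finite F]
    [Algebra (ZMod p) F] (hcard : Nat.card F = p ^ d) {G : Type*} [Group G]
    (r : G →* (F ≃ₐ[ZMod p] F)) (a : G → F) (ha : ∀ σ τ, a (σ * τ) = a σ + r σ (a τ))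
    (hinj : ∀ σ, a σ = 0 → r σ = 1 → σ = 1) (hs : ∀ x, ∃ σ, a σ = x)
    (hφ : ∃ φ, a φ = 0 ∧ ∀ x, r φ x = x ^ p) :
    ∃ e : G ≃* Wreath d p, ∀ σ, (e σ).right = 1 ↔ r σ = 1 := by
  classical
  obtain ⟨φ, hφ0, hφ⟩ := hφ
  have : NeZero d := ⟨hd.ne'⟩
  set Φ := r φ with hΦ
  have hfin : Module.finrank (ZMod p) F = d := by
    have h1 := Module.natCard_eq_pow_finrank (K := ZMod p) (V := F)
    rw [hcard, Nat.card_zmod] at h1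
    exact (Nat.pow_right_injective (Fact.out : p.Prime).two_le h1).symm
  have hΦF : Φ = FiniteField.frobeniusAlgEquivOfAlgebraic (ZMod p) F := by
    ext x
    rw [FiniteField.coe_frobeniusAlgEquivOfAlgebraic, hφ, ZMod.card]
  have hord : orderOf Φ = d := by
    rw [hΦF, FiniteField.orderOf_frobeniusAlgEquivOfAlgebraic, hfin]
  have hgen : ∀ s : F ≃ₐ[ZMod p] F, ∃ n : ℕ, Φ ^ n = s := by
    intro s
    obtain ⟨n, hn⟩ := (FiniteField.bijective_frobeniusAlgEquivOfAlgebraic_pow (ZMod p) F).2 s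
    exact ⟨n.1, by rw [hΦF]; exact hn⟩
  -- the hom from `ZMod d`
  let P : ZMod d → (F ≃ₐ[ZMod p] F) := fun i => Φ ^ i.val
  have hPcast : ∀ n : ℕ, P (n : ZMod d) = Φ ^ n := by
    intro n
    simp only [P, ZMod.val_natCast]
    rw [← hord, pow_mod_orderOf]
  have hPadd : ∀ i j, P (i + j) = P i * P j := by
    intro i j
    have : i + j = ((i.val + j.val : ℕ) : ZMod d) := by simp
    rw [this, hPcast, pow_add]
  have hP0 : P 0 = 1 := by simp [P]
  have hPinj : Function.Injective P := by
    intro i j h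
    have := pow_injOn_Iio_orderOf (x := Φ) (by simpa [hord] using ZMod.val_lt i)
      (by simpa [hord] using ZMod.val_lt j) h
    exact ZMod.val_injective d this
  have hPsurj : Function.Surjective P := by
    intro s
    obtain ⟨n, hn⟩ := hgen s
    exact ⟨n, by rw [hPcast, hn]⟩
  let Pe : ZMod d ≃ (F ≃ₐ[ZMod p] F) := Equiv.ofBijective P ⟨hPinj, hPsurj⟩
  -- normal basis
  let B := (IsGalois.normalBasis (ZMod p) F).reindex ((Equiv.neg _).trans Pe).symm
  have hB : ∀ i, B i = P (-i) (IsGalois.normalBasis (ZMod p) F 1) := by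
    intro i
    simp only [B, Module.Basis.reindex_apply, Equiv.symm_symm]
    rw [IsGalois.normalBasis_apply]
    rfl
  have hPB : ∀ s i, P s (B i) = B (i - s) := by
    intro s i
    rw [hB, hB, ← AlgEquiv.mul_apply, ← hPadd]
    congr 2
    ring
  let ψ : F ≃ₗ[ZMod p] (ZMod d → ZMod p) := B.equivFun
  have hψ : ∀ s x i, ψ (P s x) i = ψ x (i + s) := by
    intro s x i
    obtain ⟨f, rfl⟩ := ψ.symm.surjective x
    have : P s (ψ.symm f) = ψ.symm (fun i => f (i + s)) := by
      simp only [ψ, Module.Basis.equivFun_symm_apply, map_sum, map_smul, hPB]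
      rw [← Equiv.sum_comp (Equiv.addRight s)]
      simp
    rw [this]
    simp
  let b : G → ZMod d := fun σ => Pe.symm (r σ)
  have hb : ∀ σ, P (b σ) = r σ := fun σ => Pe.apply_symm_apply (r σ)
  have hbmul : ∀ σ τ, b (σ * τ) = b σ + b τ := by
    intro σ τ
    apply hPinj
    rw [hPadd, hb, hb, hb, map_mul]
  have ha1 : a 1 = 0 := by
    have := ha 1 1
    simpa using this
  have hb0 : ∀ σ, b σ = 0 ↔ r σ = 1 := by
    intro σ
    rw [← hb σ, ← hP0]
    exact hPinj.eq_iff.symm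
  let e0 : G →* Wreath d p :=
    { toFun := fun σ => ⟨Multiplicative.ofAdd (ψ (a σ)), Multiplicative.ofAdd (b σ)⟩
      map_one' := by
        have : b 1 = 0 := (hb0 1).2 (map_one r)
        simp only [ha1, this, map_zero]
        rfl
      map_mul' := by
        intro σ τ
        apply SemidirectProduct.ext
        · show Multiplicative.ofAdd (ψ (a (σ * τ))) = _
          rw [ha, map_add]
          show _ = Multiplicative.ofAdd (ψ (a σ) + fun i => ψ (a τ) (i + b σ))
          congr 2
          funext i
          rw [← hb σ, hψ]
        · show Multiplicative.ofAdd (b (σ * τ)) = Multiplicative.ofAdd (b σ + b τ)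
          rw [hbmul] }
  have he0l : ∀ σ, (e0 σ).left = Multiplicative.ofAdd (ψ (a σ)) := fun _ => rfl
  have he0r : ∀ σ, (e0 σ).right = Multiplicative.ofAdd (b σ) := fun _ => rfl
  have hbij : Function.Bijective e0 := by
    constructor
    · rw [injective_iff_map_eq_one]
      intro σ hσ
      have h1 : ψ (a σ) = 0 := congrArg (fun x => Multiplicative.toAdd x.left) hσ
      have h2 : b σ = 0 := congrArg (fun x => Multiplicative.toAdd x.right) hσ
      exact hinj σ (by simpa using h1) ((hb0 σ).1 h2)
    · rintro ⟨x, s⟩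
      obtain ⟨σ, hσ⟩ := hs (ψ.symm (Multiplicative.toAdd x))
      have hφn : ∀ n : ℕ, a (φ ^ n) = 0 := by
        intro n
        induction n with
        | zero => simpa using ha1
        | succ n ih => rw [pow_succ, ha, ih, hφ0, map_zero, add_zero]
      have hφb : b φ = 1 := by
        apply hPinj
        rw [hb]
        have := hPcast 1
        rw [Nat.cast_one, pow_one] at this
        rw [this]
      have hφnb : ∀ n : ℕ, b (φ ^ n) = n := by
        intro n
        induction n with
        | zero => simpa using (hb0 1).2 (map_one r)
        | succ n ih => rw [pow_succ, hbmul, ih, hφb, Nat.cast_succ]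
      refine ⟨σ * φ ^ (Multiplicative.toAdd s - b σ).val, ?_⟩
      apply SemidirectProduct.ext
      · rw [he0l, ha, hφn, map_zero, add_zero, hσ, LinearEquiv.apply_symm_apply]
        rfl
      · rw [he0r, hbmul, hφnb]
        simp
  refine ⟨MulEquiv.ofBijective e0 hbij, fun σ => ?_⟩
  rw [← hb0]
  rfl

end GroupPart


section ValuationPart

open scoped NNReal

set_option linter.unusedSectionVars false

variable {p} {E : Type*} [Field E] [Algebra ℚ_[p] E] {v : Valuation E ℝ≥0}

theorem asp_natDegree {R : Type*} [Field R] {n : ℕ} (hn : 2 ≤ n) (c : R) :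
    (X ^ n - X - C c : R[X]).natDegree = n := by
  have h1 : (X + C c : R[X]).natDegree < (X ^ n : R[X]).natDegree := by
    rw [natDegree_X_add_C, natDegree_X_pow]
    omega
  rw [sub_sub, natDegree_sub_eq_left_of_natDegree_lt h1, natDegree_X_pow]

theorem asp_monic {R : Type*} [Field R] {n : ℕ} (hn : 2 ≤ n) (c : R) :
    (X ^ n - X - C c : R[X]).Monic := by
  rw [sub_sub]
  apply monic_X_pow_sub
  rw [degree_X_add_C]
  exact_mod_cast hn

theorem v_p (hv : ∀ a : ℚ_[p], v (algebraMap _ E a) = ‖a‖₊) : v (p : E) = (p : ℝ≥0)⁻¹ := by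
  have := hv p
  rw [map_natCast] at this
  rw [this]
  ext
  simp

theorem v_nat (n : ℕ) : v (n : E) ≤ 1 := by
  induction n with
  | zero => simp
  | succ n ih =>
    rw [Nat.cast_succ]
    exact v.map_add_le ih (by simp)

theorem one_lt_pNN : (1 : ℝ≥0) < p := by exact_mod_cast (Fact.out : p.Prime).one_lt

theorem q_gt {d : ℕ} (hd : 0 < d) : 2 ≤ p ^ d :=
  le_trans (Fact.out : p.Prime).two_le (Nat.le_self_pow hd.ne' p)

theorem v_err (hv : ∀ a : ℚ_[p], v (algebraMap _ E a) = ‖a‖₊) {d : ℕ} (hd : 0 < d) {z t : E}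
    (hz : v z ^ (p ^ d - 1) < p) (B : ℝ≥0) (hB0 : 0 < B)
    (hB : ∀ k ∈ Finset.Ioo 0 (p ^ d), v t ^ k ≤ B) :
    v ((z + t) ^ (p ^ d) - z ^ (p ^ d) - t ^ (p ^ d)) < B := by
  have hq := q_gt (p := p) hd
  rw [add_pow_prime_pow_eq' (Fact.out : p.Prime)]
  rw [add_assoc, add_sub_cancel_left, add_sub_cancel_left, map_mul, v_p hv]
  rw [inv_mul_lt_iff₀ (by linarith [one_lt_pNN (p := p)])]
  have hpB : (0 : ℝ≥0) < p * B := mul_pos (by linarith [one_lt_pNN (p := p)]) hB0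
  apply v.map_sum_lt hpB.ne'
  intro i hi
  rw [map_mul, map_mul, map_pow, map_pow]
  have hi' := Finset.mem_Ioo.1 hi
  have h1 : v z ^ i < p := by
    rcases le_total (v z) 1 with h | h
    · exact lt_of_le_of_lt (pow_le_one₀ zero_le h) one_lt_pNN
    · exact lt_of_le_of_lt (pow_le_pow_right₀ h (by omega)) hz
  have h2 : v t ^ (p ^ d - i) ≤ B := hB _ (Finset.mem_Ioo.2 ⟨by omega, by omega⟩)
  calc v z ^ i * v t ^ (p ^ d - i) * v (((p ^ d).choose i / p : ℕ) : E)
      ≤ v z ^ i * B * 1 := by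
        gcongr
        exact v_nat _
    _ < p * B := by
        rw [mul_one]
        gcongr

/-- distance between two roots. -/
theorem v_sub_roots (hv : ∀ a : ℚ_[p], v (algebraMap _ E a) = ‖a‖₊) {d : ℕ} (hd : 0 < d)
    {z z' : E} (hz : v z ^ (p ^ d - 1) < p)
    (h : z' ^ (p ^ d) - z' = z ^ (p ^ d) - z) (hne : z' ≠ z) : v (z' - z) = 1 := by
  have hq := q_gt (p := p) hd
  obtain ⟨t, rfl⟩ : ∃ t, z' = z + t := ⟨z' - z, by ring⟩
  have ht : t ≠ 0 := by
    rintro rfl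
    simp at hne
  have ht0 : 0 < v t := by
    rw [pos_iff_ne_zero]
    exact (Valuation.ne_zero_iff v).2 ht
  rw [add_sub_cancel_left]
  have herr : t ^ (p ^ d) - t = -((z + t) ^ (p ^ d) - z ^ (p ^ d) - t ^ (p ^ d)) := by
    linear_combination h
  rcases lt_trichotomy (v t) 1 with h1 | h1 | h1
  · exfalso
    have h2 := v_err hv hd (t := t) hz (v t) ht0 (by
      intro k hk
      have := (Finset.mem_Ioo.1 hk).1
      exact pow_le_of_le_one zero_le h1.le (by omega))
    rw [← v.map_neg, ← herr] at h2
    have h3 : v (t ^ (p ^ d)) < v t := by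
      rw [map_pow]
      exact pow_lt_self_of_lt_one₀ ht0 h1 (by omega)
    rw [v.map_sub_eq_of_lt_right h3] at h2
    exact lt_irrefl _ h2
  · exact h1
  · exfalso
    have h2 := v_err hv hd (t := t) hz (v t ^ (p ^ d - 1)) (pow_pos ht0 _) (by
      intro k hk
      have := (Finset.mem_Ioo.1 hk)
      exact pow_le_pow_right₀ h1.le (by omega))
    rw [← v.map_neg, ← herr] at h2
    have h3 : v t < v (t ^ (p ^ d)) := by
      rw [map_pow]
      exact lt_self_pow₀ h1 (by omega)
    rw [v.map_sub_eq_of_lt_left h3, map_pow] at h2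
    exact absurd h2 (not_lt.2 (pow_le_pow_right₀ h1.le (by omega)))

theorem v_sub_roots' (hv : ∀ a : ℚ_[p], v (algebraMap _ E a) = ‖a‖₊) {d : ℕ} (hd : 0 < d)
    {z z' : E} (hz : v z ^ (p ^ d - 1) < p)
    (h : z' ^ (p ^ d) - z' = z ^ (p ^ d) - z) : v (z' - z) ≤ 1 ∧
      v ((z' - z) ^ (p ^ d) - (z' - z)) < 1 := by
  have h1 : v (z' - z) ≤ 1 := by
    by_cases hne : z' = z
    · simp [hne]
    · exact (v_sub_roots hv hd hz h hne).le
  refine ⟨h1, ?_⟩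
  have h2 := v_err hv hd (t := z' - z) hz 1 one_pos (fun k _ => pow_le_one₀ zero_le h1)
  rw [← v.map_neg] at h2
  convert h2 using 2
  rw [add_sub_cancel]
  linear_combination h

theorem card_roots (hv : ∀ a : ℚ_[p], v (algebraMap _ E a) = ‖a‖₊) {d : ℕ} (hd : 0 < d)
    (c : E) (hc : ∀ z : E, z ^ (p ^ d) - z = c → v z ^ (p ^ d - 1) < p)
    (hs : (X ^ (p ^ d) - X - C c : E[X]).Splits) :
    Nat.card {z : E // z ^ (p ^ d) - z = c} = p ^ d := by
  classical
  have hq := q_gt (p := p) hd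
  set h : E[X] := X ^ (p ^ d) - X - C c with hh
  have hdeg : h.natDegree = p ^ d := by
    rw [hh]
    exact asp_natDegree hq c
  have h0 : h ≠ 0 := by
    intro h'
    rw [h'] at hdeg
    simp at hdeg
    omega
  have hroot : ∀ z, z ∈ h.roots ↔ z ^ (p ^ d) - z = c := by
    intro z
    rw [mem_roots h0, IsRoot.def, hh]
    simp [sub_eq_zero]
  have hnd : h.roots.Nodup := by
    rw [Multiset.nodup_iff_count_le_one]
    intro z
    by_contra hcon
    push Not at hcon
    rw [count_roots, one_lt_rootMultiplicity_iff_isRoot h0] at hcon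
    have hz := (hroot z).1 ((mem_roots h0).2 hcon.1)
    have h3 := hcon.2
    rw [hh, IsRoot.def] at h3
    simp only [derivative_sub, derivative_X_pow, derivative_X, derivative_C, eval_sub, eval_mul,
      eval_pow, eval_X, eval_one, sub_zero, sub_eq_zero, map_natCast, eval_natCast] at h3
    have h4 := congrArg v h3
    rw [map_mul, map_pow, map_one] at h4
    have h5 : v ((p ^ d : ℕ) : E) ≤ (p : ℝ≥0)⁻¹ := by
      obtain ⟨k, rfl⟩ : ∃ k, d = k + 1 := ⟨d - 1, by omega⟩
      rw [pow_succ, Nat.cast_mul, map_mul, v_p hv]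
      exact mul_le_of_le_one_left zero_le (v_nat _)
    have h6 := hc z hz
    have hp1 := one_lt_pNN (p := p)
    have : v ((p ^ d : ℕ) : E) * v z ^ (p ^ d - 1) < 1 := by
      calc v ((p ^ d : ℕ) : E) * v z ^ (p ^ d - 1) ≤ (p : ℝ≥0)⁻¹ * v z ^ (p ^ d - 1) := by gcongr
        _ < (p : ℝ≥0)⁻¹ * p := by
          have : (0 : ℝ≥0) < (p : ℝ≥0)⁻¹ := inv_pos.2 (by linarith)
          gcongr
        _ = 1 := inv_mul_cancel₀ (by positivity)
    exact absurd h4 this.ne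
  have e : {z : E // z ^ (p ^ d) - z = c} ≃ {z // z ∈ h.roots.toFinset} :=
    Equiv.subtypeEquivRight (fun z => by rw [Multiset.mem_toFinset, hroot])
  rw [Nat.card_congr e, Nat.card_eq_fintype_card, Fintype.card_coe,
    Multiset.toFinset_card_of_nodup hnd, ← hdeg]
  exact hs.natDegree_eq_card_roots.symm

theorem v_of_root {d : ℕ} (hd : 0 < d) {z c : E} (hc : v c = p) (h : z ^ (p ^ d) - z = c) :
    v z ^ (p ^ d) = p := by
  have hq := q_gt (p := p) hd
  have hp1 := one_lt_pNN (p := p)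
  rcases le_or_gt (v z) 1 with h1 | h1
  · exfalso
    have : v c ≤ 1 := by
      rw [← h]
      exact v.map_sub_le (by rw [map_pow]; exact pow_le_one₀ zero_le h1) h1
    rw [hc] at this
    exact absurd this (not_le.2 hp1)
  · have h3 : v z < v (z ^ (p ^ d)) := by
      rw [map_pow]
      exact lt_self_pow₀ h1 (by omega)
    rw [← hc, ← h, v.map_sub_eq_of_lt_left h3, map_pow]

theorem one_lt_of_root {d : ℕ} {x : ℝ≥0} (h : x ^ (p ^ d) = p) : 1 < x := by
  by_contra hx
  push Not at hx
  have : x ^ (p ^ d) ≤ 1 := pow_le_one₀ zero_le hx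
  rw [h] at this
  exact absurd this (not_le.2 one_lt_pNN)

theorem v_of_root' {d : ℕ} (hd : 0 < d) {x : ℝ≥0} (h : x ^ (p ^ d) = p) :
    x ^ (p ^ d - 1) < p := by
  have hq := q_gt (p := p) hd
  rw [← h]
  exact pow_lt_pow_right₀ (one_lt_of_root h) (by omega)

theorem v_teich {d : ℕ} (hd : 0 < d) {z : E} (h : z ^ (p ^ d) - z = 0) : v z ≤ 1 := by
  have hq := q_gt (p := p) hd
  by_contra h1
  push Not at h1
  have h3 : v z < v (z ^ (p ^ d)) := by
    rw [map_pow]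
    exact lt_self_pow₀ h1 (by omega)
  rw [sub_eq_zero.1 h] at h3
  exact lt_irrefl _ h3

theorem v_teich' {d : ℕ} (hd : 0 < d) {z : E} (h : z ^ (p ^ d) - z = 0) :
    v z ^ (p ^ d - 1) < p :=
  lt_of_le_of_lt (pow_le_one₀ zero_le (v_teich hd h)) one_lt_pNN

theorem v_sum_ge {ι : Type*} (s : Finset ι) (f : ι → E)
    (hf : ∀ i ∈ s, ∀ j ∈ s, i ≠ j → f i ≠ 0 → v (f i) ≠ v (f j)) :
    ∀ i ∈ s, v (f i) ≤ v (∑ j ∈ s, f j) := by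
  classical
  intro i hi
  obtain ⟨m, hm, hmax⟩ := s.exists_max_image (fun j => v (f j)) ⟨i, hi⟩
  refine (hmax i hi).trans ?_
  by_cases h0 : f m = 0
  · simp [h0]
  rw [← Finset.add_sum_erase s f hm, v.map_add_eq_of_lt_left]
  apply v.map_sum_lt ((Valuation.ne_zero_iff v).2 h0)
  intro j hj
  rw [Finset.mem_erase] at hj
  exact lt_of_le_of_ne (hmax j hj.2) (hf m hm j hj.2 hj.1.symm h0).symm

theorem norm_pow_ne {d i j : ℕ} (hi : i < p ^ d) (hj : j < p ^ d) {x : ℝ≥0} (h : x ^ (p ^ d) = p)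
    {a b : ℚ_[p]} (ha : a ≠ 0) (hb : b ≠ 0) (he : ‖a‖₊ * x ^ i = ‖b‖₊ * x ^ j) : i = j := by
  have hp1 := one_lt_pNN (p := p)
  have hp0 : (p : ℝ) ≠ 0 := by
    have := (Fact.out : p.Prime).ne_zero
    exact_mod_cast this
  have key : ∀ (a : ℚ_[p]) (i : ℕ), a ≠ 0 → (((‖a‖₊ * x ^ i) ^ (p ^ d) : ℝ≥0) : ℝ) =
      (p : ℝ) ^ (-a.valuation * (p ^ d : ℕ) + i) := by
    intro a i ha
    rw [mul_pow, ← pow_mul, mul_comm i, pow_mul, h]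
    push_cast
    rw [Padic.norm_eq_zpow_neg_valuation ha, zpow_add₀ hp0, zpow_mul]
    norm_cast
  have h1 := key a i ha
  rw [he, key b j hb] at h1
  have h2 := zpow_right_injective₀ (a := (p : ℝ)) (by
    have := (Fact.out : p.Prime).pos
    exact_mod_cast this) (by
    have := (Fact.out : p.Prime).ne_one
    exact_mod_cast this) h1
  set q := p ^ d
  have h3 : ((j : ℤ) - i) = (q : ℤ) * (b.valuation - a.valuation) := by
    push_cast [q] at h2 ⊢
    linear_combination h2
  have h4 : ((j : ℤ) - i) = 0 := by
    apply Int.eq_zero_of_abs_lt_dvd (m := (q : ℤ)) ⟨_, h3⟩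
    rw [abs_lt]
    constructor <;> omega
  omega

theorem v_coeff_le (hv : ∀ a : ℚ_[p], v (algebraMap _ E a) = ‖a‖₊) {d : ℕ} {z : E}
    (hz : v z ^ (p ^ d) = p) (P : ℚ_[p][X]) (hP : P.natDegree < p ^ d) (i : ℕ) (hi : i < p ^ d) :
    ‖P.coeff i‖₊ * v z ^ i ≤ v (aeval z P) := by
  rw [aeval_eq_sum_range' hP]
  have hz1 := one_lt_of_root hz
  have hvf : ∀ j, v (P.coeff j • z ^ j) = ‖P.coeff j‖₊ * v z ^ j := by
    intro j
    rw [Algebra.smul_def, map_mul, map_pow, hv]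
  have := v_sum_ge (v := v) (Finset.range (p ^ d)) (fun j => P.coeff j • z ^ j) (by
    intro k hk j hj hkj h0 he
    rw [hvf, hvf] at he
    have hk0 : P.coeff k ≠ 0 := by
      rintro hh
      simp [hh] at h0
    have hj0 : P.coeff j ≠ 0 := by
      rintro hh
      rw [hh, nnnorm_zero, zero_mul] at he
      have : (0 : ℝ≥0) < ‖P.coeff k‖₊ * v z ^ k :=
        mul_pos (nnnorm_pos.2 hk0) (pow_pos (by linarith) _)
      exact this.ne' he
    exact hkj (norm_pow_ne (Finset.mem_range.1 hk) (Finset.mem_range.1 hj) hz hk0 hj0 he))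
    i (Finset.mem_range.2 hi)
  rw [hvf] at this
  exact this

/-- the Artin-Schreier like polynomial over `ℚ_p`. -/
noncomputable def gP (p : ℕ) [Fact p.Prime] (d : ℕ) : ℚ_[p][X] := X ^ (p ^ d) - X - C (-(p : ℚ_[p])⁻¹)

theorem gP_natDegree {d : ℕ} (hd : 0 < d) : (gP p d).natDegree = p ^ d := by
  have hq := q_gt (p := p) hd
  rw [gP]
  exact asp_natDegree hq _

theorem gP_monic {d : ℕ} (hd : 0 < d) : (gP p d).Monic := by
  have hq := q_gt (p := p) hd
  rw [gP]
  exact asp_monic hq _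

theorem gP_aeval {d : ℕ} (z : E) :
    aeval z (gP p d) = z ^ (p ^ d) - z - -((p : E)⁻¹) := by
  simp [gP]

theorem v_neg_p_inv (hv : ∀ a : ℚ_[p], v (algebraMap _ E a) = ‖a‖₊) : v (-((p : E)⁻¹)) = p := by
  rw [v.map_neg, map_inv₀, v_p hv, inv_inv]

theorem gP_minpoly (hv : ∀ a : ℚ_[p], v (algebraMap _ E a) = ‖a‖₊) {d : ℕ} (hd : 0 < d) {z : E}
    (h : z ^ (p ^ d) - z = -((p : E)⁻¹)) : minpoly ℚ_[p] z = gP p d := by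
  have hz := v_of_root hd (v_neg_p_inv hv) h
  have h0 : aeval z (gP p d) = 0 := by rw [gP_aeval, h, sub_self]
  have hzint : IsIntegral ℚ_[p] z := ⟨gP p d, gP_monic hd, h0⟩
  have hdvd := minpoly.dvd _ _ h0
  have hle := natDegree_le_of_dvd hdvd (gP_monic hd).ne_zero
  rw [gP_natDegree hd] at hle
  rcases hle.lt_or_eq with hlt | heq
  · exfalso
    have := v_coeff_le hv hz _ hlt _ hlt
    rw [minpoly.aeval, map_zero, coeff_natDegree, (minpoly.monic hzint).leadingCoeff, nnnorm_one,
      one_mul] at this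
    have h1 := one_lt_of_root hz
    exact absurd this (not_le.2 (pow_pos (by linarith) _))
  · exact eq_of_monic_of_dvd_of_natDegree_le (minpoly.monic hzint) (gP_monic hd) hdvd
      (by rw [gP_natDegree hd, heq]) |>.symm

theorem resid_nat (hv : ∀ a : ℚ_[p], v (algebraMap _ E a) = ‖a‖₊) {d : ℕ} (hd : 0 < d) {z : E}
    (h : z ^ (p ^ d) - z = -((p : E)⁻¹)) (x : E) (hx : x ∈ ℚ_[p]⟮z⟯) (hx1 : v x ≤ 1) :
    ∃ n : ℕ, v (x - n) < 1 := by
  have hz := v_of_root hd (v_neg_p_inv hv) h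
  have hq := q_gt (p := p) hd
  have hp1 := one_lt_pNN (p := p)
  have h0 : aeval z (gP p d) = 0 := by rw [gP_aeval, h, sub_self]
  have hzint : IsIntegral ℚ_[p] z := ⟨gP p d, gP_monic hd, h0⟩
  have hz1 := one_lt_of_root hz
  obtain ⟨P, hP, rfl⟩ : ∃ P : ℚ_[p][X], P.natDegree < p ^ d ∧ aeval z P = x := by
    rw [← IntermediateField.mem_toSubalgebra,
      IntermediateField.adjoin_simple_toSubalgebra_of_isAlgebraic hzint.isAlgebraic,
      Algebra.adjoin_singleton_eq_range_aeval] at hx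
    obtain ⟨P, rfl⟩ := hx
    refine ⟨P %ₘ gP p d, ?_, ?_⟩
    · rw [← gP_natDegree hd]
      apply natDegree_modByMonic_lt _ (gP_monic hd)
      intro h1
      have := gP_natDegree (p := p) hd
      rw [h1] at this
      simp at this
      omega
    · exact aeval_modByMonic_eq_self_of_root h0
  have hco : ∀ i < p ^ d, ‖P.coeff i‖₊ * v z ^ i ≤ 1 := fun i hi =>
    (v_coeff_le hv hz P hP i hi).trans hx1
  have hco0 : ‖P.coeff 0‖ ≤ 1 := by
    have := hco 0 (by omega)
    rw [pow_zero, mul_one] at this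
    exact_mod_cast this
  have hlt : v (aeval z P - algebraMap _ E (P.coeff 0)) < 1 := by
    have : aeval z P = ∑ i ∈ Finset.range (p ^ d - 1), P.coeff (i + 1) • z ^ (i + 1) +
        algebraMap _ E (P.coeff 0) := by
      rw [aeval_eq_sum_range' hP]
      obtain ⟨k, hk⟩ : ∃ k, p ^ d = k + 1 := ⟨p ^ d - 1, by omega⟩
      rw [hk, Finset.sum_range_succ', Nat.add_sub_cancel, pow_zero, Algebra.algebraMap_eq_smul_one]
    rw [this, add_sub_cancel_right]
    apply v.map_sum_lt one_ne_zero
    intro i hi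
    have hi' := Finset.mem_range.1 hi
    rw [Algebra.smul_def, map_mul, map_pow, hv]
    have h1 := hco (i + 1) (by omega)
    have h2 : ‖P.coeff (i + 1)‖₊ < 1 := by
      by_contra hcon
      push Not at hcon
      have : 1 < v z ^ (i + 1) := one_lt_pow₀ hz1 (by omega)
      have : 1 < ‖P.coeff (i + 1)‖₊ * v z ^ (i + 1) := lt_of_lt_of_le this
        (le_mul_of_one_le_left zero_le hcon)
      exact absurd h1 (not_le.2 this)
    have h3 : ‖P.coeff (i + 1)‖₊ ≤ (p : ℝ≥0)⁻¹ := by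
      have h4 : ‖P.coeff (i + 1)‖ < 1 := by exact_mod_cast h2
      have h5 := (Padic.norm_le_pow_iff_norm_lt_pow_add_one (P.coeff (i+1)) (-1)).2 (by simpa using h4)
      rw [zpow_neg_one] at h5
      exact_mod_cast h5
    have h6 : v z ^ (i + 1) < p := lt_of_le_of_lt (pow_le_pow_right₀ hz1.le (by omega))
      (v_of_root' hd hz)
    calc ‖P.coeff (i + 1)‖₊ * v z ^ (i + 1) ≤ (p : ℝ≥0)⁻¹ * v z ^ (i + 1) := by gcongr
      _ < (p : ℝ≥0)⁻¹ * p := by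
          have : (0 : ℝ≥0) < (p : ℝ≥0)⁻¹ := inv_pos.2 (by linarith)
          gcongr
      _ = 1 := inv_mul_cancel₀ (by positivity)
  obtain ⟨n, ⟨-, hn⟩, -⟩ := PadicInt.existsUnique_mem_range (⟨P.coeff 0, hco0⟩ : ℤ_[p])
  refine ⟨n, ?_⟩
  rw [IsLocalRing.mem_maximalIdeal, PadicInt.mem_nonunits] at hn
  have hn' : v (algebraMap _ E (P.coeff 0 - n)) < 1 := by
    rw [hv]
    have : ‖P.coeff 0 - n‖ < 1 := hn
    exact_mod_cast this
  have : aeval z P - (n : E) = (aeval z P - algebraMap _ E (P.coeff 0)) +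
      algebraMap _ E (P.coeff 0 - n) := by
    rw [map_sub, map_natCast]
    ring
  rw [this]
  exact v.map_add_lt hlt hn'

end ValuationPart


section ResiduePart

open scoped NNReal

variable {p} {E : Type*} [Field E] [Algebra ℚ_[p] E] {v : Valuation E ℝ≥0}

/-- A reduction map modulo the maximal ideal. -/
structure Resid (v : Valuation E ℝ≥0) (κ : Type*) [Field κ] where
  ρ : E → κ
  map_add : ∀ x y, v x ≤ 1 → v y ≤ 1 → ρ (x + y) = ρ x + ρ y
  map_mul : ∀ x y, v x ≤ 1 → v y ≤ 1 → ρ (x * y) = ρ x * ρ y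
  map_one : ρ 1 = 1
  surj : ∀ k, ∃ x, v x ≤ 1 ∧ ρ x = k
  zero_iff : ∀ x, v x ≤ 1 → (ρ x = 0 ↔ v x < 1)

open Classical in
noncomputable def theResid (v : Valuation E ℝ≥0) :
    Resid v (IsLocalRing.ResidueField v.valuationSubring) where
  ρ x := if h : v x ≤ 1 then IsLocalRing.residue v.valuationSubring ⟨x, h⟩ else 0
  map_add x y hx hy := by
    rw [dif_pos hx, dif_pos hy, dif_pos (v.map_add_le hx hy), ← _root_.map_add]
    rfl
  map_mul x y hx hy := by
    have : v (x * y) ≤ 1 := by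
      rw [_root_.map_mul]
      exact mul_le_one' hx hy
    rw [dif_pos hx, dif_pos hy, dif_pos this, ← _root_.map_mul]
    rfl
  map_one := by
    rw [dif_pos (by simp)]
    exact _root_.map_one (IsLocalRing.residue v.valuationSubring)
  surj k := by
    obtain ⟨⟨x, hx⟩, rfl⟩ := IsLocalRing.residue_surjective k
    exact ⟨x, hx, dif_pos hx⟩
  zero_iff x hx := by
    rw [dif_pos hx, IsLocalRing.residue_eq_zero_iff, ValuationSubring.valuation_lt_one_iff]
    exact (v.isEquiv_valuation_valuationSubring.lt_one_iff_lt_one (x := x)).symm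

namespace Resid

variable {κ : Type*} [Field κ] (R : Resid v κ)

theorem map_zero : R.ρ 0 = 0 := (R.zero_iff 0 (by simp)).2 (by simp)

theorem map_neg (x : E) (hx : v x ≤ 1) : R.ρ (-x) = - R.ρ x := by
  have := R.map_add x (-x) hx (by rwa [v.map_neg])
  rw [add_neg_cancel, R.map_zero] at this
  linear_combination -this

theorem map_sub (x y : E) (hx : v x ≤ 1) (hy : v y ≤ 1) : R.ρ (x - y) = R.ρ x - R.ρ y := by
  rw [sub_eq_add_neg, R.map_add x (-y) hx (by rwa [v.map_neg]), R.map_neg y hy, sub_eq_add_neg]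

theorem eq_iff (x y : E) (hx : v x ≤ 1) (hy : v y ≤ 1) : R.ρ x = R.ρ y ↔ v (x - y) < 1 := by
  rw [← R.zero_iff _ (v.map_sub_le hx hy), R.map_sub x y hx hy, sub_eq_zero]

theorem map_pow (x : E) (hx : v x ≤ 1) (n : ℕ) : R.ρ (x ^ n) = R.ρ x ^ n := by
  induction n with
  | zero => simp [R.map_one]
  | succ n ih =>
    rw [pow_succ, R.map_mul _ _ (by rw [_root_.map_pow]; exact pow_le_one₀ zero_le hx) hx, ih,
      pow_succ]

theorem map_nat (n : ℕ) : R.ρ n = n := by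
  induction n with
  | zero => simp [R.map_zero]
  | succ n ih =>
    rw [Nat.cast_succ, R.map_add _ _ (v_nat n) (by simp), ih, R.map_one, Nat.cast_succ]

theorem map_sum {ι : Type*} (s : Finset ι) (f : ι → E) (hf : ∀ i ∈ s, v (f i) ≤ 1) :
    R.ρ (∑ i ∈ s, f i) = ∑ i ∈ s, R.ρ (f i) := by
  classical
  induction s using Finset.induction_on with
  | empty => simp [R.map_zero]
  | insert a s ha ih =>
    rw [Finset.sum_insert ha, Finset.sum_insert ha,
      R.map_add _ _ (hf a (by simp)) (v.map_sum_le fun i hi => hf i (by simp [hi])),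
      ih fun i hi => hf i (by simp [hi])]

end Resid

theorem Resid.charP {κ : Type*} [Field κ] (R : Resid v κ)
    (hv : ∀ a : ℚ_[p], v (algebraMap _ E a) = ‖a‖₊) : CharP κ p := by
  rw [CharP.charP_iff_prime_eq_zero (Fact.out : p.Prime), ← R.map_nat, R.zero_iff _ (v_nat p),
    v_p hv]
  exact inv_lt_one_of_one_lt₀ one_lt_pNN

theorem coeff_prod_le (s : Multiset E) (hs : ∀ a ∈ s, v a ≤ 1) (i : ℕ) :
    v ((s.map fun a => X - C a).prod.coeff i) ≤ 1 := by
  have h : (s.map fun a => X - C a).prod ∈ Polynomial.lifts v.valuationSubring.subtype := by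
    apply multiset_prod_mem
    intro P hP
    obtain ⟨a, ha, rfl⟩ := Multiset.mem_map.1 hP
    rw [sub_eq_add_neg, ← C_neg]
    apply add_mem (X_mem_lifts _)
    exact C'_mem_lifts ⟨⟨-a, by rw [Valuation.mem_valuationSubring_iff, v.map_neg]; exact hs a ha⟩, rfl⟩
  rw [lifts_iff_coeff_lifts] at h
  obtain ⟨y, hy⟩ := h i
  rw [← hy]
  exact y.2

theorem exists_frob (hv : ∀ a : ℚ_[p], v (algebraMap _ E a) = ‖a‖₊) [Normal ℚ_[p] E]
    {κ : Type*} [Field κ] (R : Resid v κ) {d : ℕ} (hd : 0 < d) {z ζ : E}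
    (hz : z ^ (p ^ d) - z = -((p : E)⁻¹)) (hζ : ζ ^ (p ^ d) - ζ = 0) :
    ∃ φ : E ≃ₐ[ℚ_[p]] E, φ z = z ∧ φ ζ = ζ ^ p := by
  have : CharP κ p := R.charP hv
  have hζp : (ζ ^ p) ^ (p ^ d) - ζ ^ p = 0 := by
    rw [← pow_mul, mul_comm, pow_mul, sub_eq_zero.1 hζ, sub_self]
  let L := ℚ_[p]⟮z⟯
  have hN : Normal L E := Normal.tower_top_of_normal ℚ_[p] L E
  have hzint : IsIntegral L ζ := hN.isIntegral ζ
  let P := minpoly L ζ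
  have hPs : (P.map (algebraMap L E)).Splits := hN.splits ζ
  have hPm : (P.map (algebraMap L E)).Monic := (minpoly.monic hzint).map _
  have hPr : ∀ a ∈ (P.map (algebraMap L E)).roots, a ^ (p ^ d) - a = 0 := by
    intro a ha
    rw [mem_roots hPm.ne_zero, IsRoot.def, eval_map_algebraMap] at ha
    have h1 : P ∣ (X ^ (p ^ d) - X) := minpoly.dvd _ _ (by simp [hζ])
    obtain ⟨Q, hQ⟩ := h1
    have h2 := congrArg (aeval a) hQ
    rw [_root_.map_mul, ha, zero_mul] at h2
    simpa using h2
  have hprod : P.map (algebraMap L E) =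
      ((P.map (algebraMap L E)).roots.map fun a => X - C a).prod :=
    hPs.eq_prod_roots_of_monic hPm
  have hco : ∀ i, v ((P.map (algebraMap L E)).coeff i) ≤ 1 := by
    intro i
    rw [hprod]
    exact coeff_prod_le _ (fun a ha => v_teich hd (hPr a ha)) i
  have hcop : ∀ i, R.ρ ((P.map (algebraMap L E)).coeff i) ^ p =
      R.ρ ((P.map (algebraMap L E)).coeff i) := by
    intro i
    obtain ⟨n, hn⟩ := resid_nat hv hd hz ((P.map (algebraMap L E)).coeff i) (by
      rw [coeff_map]
      exact (P.coeff i).2) (hco i)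
    rw [(R.eq_iff _ _ (hco i) (v_nat n)).2 hn, R.map_nat]
    exact map_natCast (frobenius κ p) n
  have hζ1 := v_teich (v := v) hd hζ
  have hev : ∀ x : E, v x ≤ 1 → R.ρ (aeval x P) = ∑ i ∈ Finset.range (P.natDegree + 1),
      R.ρ ((P.map (algebraMap L E)).coeff i) * R.ρ x ^ i := by
    intro x hx
    have hxi : ∀ i : ℕ, v (x ^ i) ≤ 1 := fun i => by
      rw [_root_.map_pow]; exact pow_le_one₀ zero_le hx
    rw [aeval_eq_sum_range, R.map_sum]
    · refine Finset.sum_congr rfl fun i _ => ?_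
      rw [Algebra.smul_def, ← coeff_map, R.map_mul _ _ (hco i) (hxi i), R.map_pow x hx]
    · intro i _
      rw [Algebra.smul_def, ← coeff_map, _root_.map_mul]
      exact mul_le_one' (hco i) (hxi i)
  have hζp1 : v (ζ ^ p) ≤ 1 := v_teich hd hζp
  have hfrob : R.ρ (aeval (ζ ^ p) P) = 0 := by
    have h1 := hev ζ hζ1
    rw [minpoly.aeval, R.map_zero] at h1
    have h2 := congrArg (frobenius κ p) h1
    rw [_root_.map_zero, _root_.map_sum] at h2
    rw [hev _ hζp1, h2]
    refine Finset.sum_congr rfl fun i _ => ?_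
    rw [frobenius_def, mul_pow, hcop, R.map_pow ζ hζ1, ← pow_mul, ← pow_mul, mul_comm p i]
  have hroot : aeval (ζ ^ p) P = 0 := by
    by_contra hne
    have heq : aeval (ζ ^ p) P =
        ((P.map (algebraMap L E)).roots.map fun a => ζ ^ p - a).prod := by
      rw [← eval_map_algebraMap]
      conv_lhs => rw [hprod]
      rw [eval_multiset_prod, Multiset.map_map]
      simp
    have hv1 : v (aeval (ζ ^ p) P) = 1 := by
      rw [heq, _root_.map_multiset_prod, Multiset.map_map]
      apply Multiset.prod_eq_one
      intro y hy
      obtain ⟨a, ha, rfl⟩ := Multiset.mem_map.1 hy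
      have ha0 := hPr a ha
      apply v_sub_roots hv hd (v_teich' hd ha0) (by rw [hζp, ha0])
      rintro rfl
      rw [mem_roots hPm.ne_zero, IsRoot.def, eval_map_algebraMap] at ha
      exact hne ha
    rw [R.zero_iff _ hv1.le] at hfrob
    exact hfrob.ne hv1
  have hconj : IsConjRoot L ζ (ζ ^ p) := by
    rw [isConjRoot_iff_aeval_eq_zero hzint]
    exact hroot
  obtain ⟨φ, hφ⟩ := isConjRoot_iff_exists_algEquiv.1 hconj.symm
  refine ⟨φ.restrictScalars ℚ_[p], ?_, hφ⟩
  exact φ.commutes ⟨z, IntermediateField.mem_adjoin_simple_self _ z⟩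

theorem main_abstract (hv : ∀ a : ℚ_[p], v (algebraMap _ E a) = ‖a‖₊) [Normal ℚ_[p] E]
    (hinv : ∀ (σ : E ≃ₐ[ℚ_[p]] E) x, v (σ x) = v x) {d : ℕ} (hd : 0 < d)
    (hT : (X ^ (p ^ d) - X - C 0 : E[X]).Splits)
    (hZ : (X ^ (p ^ d) - X - C (-((p : E)⁻¹)) : E[X]).Splits)
    (hgen : ∀ σ : E ≃ₐ[ℚ_[p]] E, (∀ t, t ^ (p ^ d) - t = 0 → σ t = t) →
      (∀ z, z ^ (p ^ d) - z = -((p : E)⁻¹) → σ z = z) → σ = 1) :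
    ∃ e : (E ≃ₐ[ℚ_[p]] E) ≃* Wreath d p,
      ∀ σ, (e σ).right = 1 ↔ ∀ t, t ^ (p ^ d) - t = 0 → σ t = t := by
  classical
  have hq := q_gt (p := p) hd
  let κ := IsLocalRing.ResidueField v.valuationSubring
  let R : Resid v κ := theResid v
  have : CharP κ p := R.charP hv
  have : ExpChar κ p := ExpChar.prime (Fact.out : p.Prime)
  let F : Subfield κ := (iterateFrobenius κ p d).eqLocusField (RingHom.id κ)
  have hF : ∀ x : κ, x ∈ F ↔ x ^ (p ^ d) = x := by
    intro x
    rw [RingHom.mem_eqLocusField, iterateFrobenius_def]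
    rfl
  let h : κ[X] := X ^ (p ^ d) - X - C 0
  have hhd : h.natDegree = p ^ d := asp_natDegree hq _
  have hh0 : h ≠ 0 := (asp_monic hq _).ne_zero
  have hsub : (F : Set κ) ⊆ h.roots.toFinset := by
    intro x hx
    have := (hF x).1 hx
    rw [Finset.mem_coe, Multiset.mem_toFinset, mem_roots hh0]
    simp [h, this]
  have hfin : Finite F := (Finset.finite_toSet _).subset hsub
  have hcardle : Nat.card F ≤ p ^ d := by
    calc Nat.card F = (F : Set κ).ncard := rfl
      _ ≤ (h.roots.toFinset : Set κ).ncard := Set.ncard_le_ncard hsub (Finset.finite_toSet _)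
      _ ≤ p ^ d := by
        rw [Set.ncard_coe_finset]
        exact (Multiset.toFinset_card_le _).trans ((card_roots' h).trans hhd.le)
  -- Teichmüller elements
  let T := {t : E // t ^ (p ^ d) - t = 0}
  have hTcard : Nat.card T = p ^ d := card_roots hv hd 0 (fun z hz => v_teich' hd hz) hT
  let fT : T → F := fun t => ⟨R.ρ t.1, by
    rw [hF, ← R.map_pow _ (v_teich hd t.2), sub_eq_zero.1 t.2]⟩
  have hTinj : ∀ t t' : E, t ^ (p ^ d) - t = 0 → t' ^ (p ^ d) - t' = 0 → R.ρ t = R.ρ t' →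
      t = t' := by
    intro t t' ht ht' he
    by_contra hne
    rw [R.eq_iff _ _ (v_teich hd ht) (v_teich hd ht')] at he
    exact he.ne (v_sub_roots hv hd (v_teich' hd ht') (by rw [ht, ht']) hne)
  have hfTinj : Function.Injective fT := by
    intro t t' he
    exact Subtype.ext (hTinj _ _ t.2 t'.2 (congrArg Subtype.val he))
  have hfTbij : Function.Bijective fT :=
    Function.Injective.bijective_of_nat_card_le hfTinj (by rw [hTcard]; exact hcardle)
  have hFcard : Nat.card F = p ^ d := by rw [← Nat.card_eq_of_bijective fT hfTbij, hTcard]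
  -- the Artin-Schreier roots
  let c : E := -((p : E)⁻¹)
  have hvz : ∀ z : E, z ^ (p ^ d) - z = c → v z ^ (p ^ d - 1) < p := fun z hz =>
    v_of_root' hd (v_of_root hd (v_neg_p_inv hv) hz)
  let Z := {z : E // z ^ (p ^ d) - z = c}
  have hZcard : Nat.card Z = p ^ d := card_roots hv hd c hvz hZ
  obtain ⟨⟨z0, hz0⟩⟩ : Nonempty Z := by
    have : Nat.card Z ≠ 0 := by omega
    exact (Nat.card_ne_zero.1 this).1
  have hZdiff : ∀ z : E, z ^ (p ^ d) - z = c → v (z - z0) ≤ 1 ∧ R.ρ (z - z0) ∈ F := by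
    intro z hz
    obtain ⟨h1, h2⟩ := v_sub_roots' hv hd (hvz z0 hz0) (hz.trans hz0.symm)
    refine ⟨h1, ?_⟩
    rw [hF, ← R.map_pow _ h1, R.eq_iff _ _ _ h1]
    · exact h2
    · rw [map_pow]
      exact pow_le_one₀ zero_le h1
  have hZinj : ∀ z z' : E, z ^ (p ^ d) - z = c → z' ^ (p ^ d) - z' = c →
      R.ρ (z - z0) = R.ρ (z' - z0) → z = z' := by
    intro z z' hz hz' he
    by_contra hne
    rw [R.eq_iff _ _ (hZdiff z hz).1 (hZdiff z' hz').1, sub_sub_sub_cancel_right] at he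
    exact he.ne (v_sub_roots hv hd (hvz z' hz') (hz.trans hz'.symm) hne)
  let fZ : Z → F := fun z => ⟨R.ρ (z.1 - z0), (hZdiff z.1 z.2).2⟩
  have hfZbij : Function.Bijective fZ :=
    Function.Injective.bijective_of_nat_card_le (fun z z' he =>
      Subtype.ext (hZinj _ _ z.2 z'.2 (congrArg Subtype.val he))) (by rw [hZcard]; exact hcardle)
  have hσT : ∀ (σ : E ≃ₐ[ℚ_[p]] E) t, t ^ (p ^ d) - t = 0 → (σ t) ^ (p ^ d) - σ t = 0 := by
    intro σ t ht
    rw [← map_pow, ← map_sub, ht, map_zero]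
  have hσZ : ∀ (σ : E ≃ₐ[ℚ_[p]] E) t, t ^ (p ^ d) - t = c → (σ t) ^ (p ^ d) - σ t = c := by
    intro σ t ht
    rw [← map_pow, ← map_sub, ht]
    simp [c]
  -- the action on the residue field
  have : CharP F p := inferInstance
  let algF : Algebra (ZMod p) F := ZMod.algebra F p
  have hwell : ∀ (σ : E ≃ₐ[ℚ_[p]] E) x y, v x ≤ 1 → v y ≤ 1 → R.ρ x = R.ρ y →
      R.ρ (σ x) = R.ρ (σ y) := by
    intro σ x y hx hy he
    rw [R.eq_iff _ _ hx hy] at he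
    rw [R.eq_iff _ _ (by rwa [hinv]) (by rwa [hinv]), ← map_sub, hinv]
    exact he
  have hr : ∀ σ : E ≃ₐ[ℚ_[p]] E, ∃ f : F ≃ₐ[ZMod p] F, ∀ x, v x ≤ 1 → ∀ u : F, R.ρ x = u →
      R.ρ (σ x) = f u := by
    intro σ
    choose s hs1 hs2 using R.surj
    have hv1 : ∀ x, v x ≤ 1 → v (σ x) ≤ 1 := fun x hx => by rwa [hinv]
    have key : ∀ x, v x ≤ 1 → R.ρ (σ (s (R.ρ x))) = R.ρ (σ x) := fun x hx =>
      hwell σ _ _ (hs1 _) hx (hs2 _)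
    let f0 : κ →+* κ :=
      { toFun := fun k => R.ρ (σ (s k))
        map_one' := by
          have := key 1 (by simp)
          rw [R.map_one, map_one, R.map_one] at this
          exact this
        map_zero' := by
          have := key 0 (by simp)
          rw [R.map_zero, map_zero, R.map_zero] at this
          exact this
        map_mul' := by
          intro a b
          have h1 : v (s a * s b) ≤ 1 := by
            rw [map_mul]
            exact mul_le_one' (hs1 a) (hs1 b)
          have := key _ h1
          rw [R.map_mul _ _ (hs1 a) (hs1 b), map_mul, R.map_mul _ _ (hv1 _ (hs1 a))
            (hv1 _ (hs1 b)), hs2, hs2] at this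
          exact this
        map_add' := by
          intro a b
          have := key _ (v.map_add_le (hs1 a) (hs1 b))
          rw [R.map_add _ _ (hs1 a) (hs1 b), map_add, R.map_add _ _ (hv1 _ (hs1 a))
            (hv1 _ (hs1 b)), hs2, hs2] at this
          exact this }
    have hf0F : ∀ u : F, f0 u ∈ F := by
      intro u
      rw [hF, ← map_pow, (hF _).1 u.2]
    let f1 : F →+* F := (f0.comp F.subtype).codRestrict F hf0F
    have hbij : Function.Bijective f1 :=
      Finite.injective_iff_bijective.1 f1.injective
    refine ⟨AlgEquiv.ofRingEquiv (f := RingEquiv.ofBijective f1 hbij) ?_, ?_⟩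
    · intro x
      exact RingHom.congr_fun (Subsingleton.elim (f1.comp (algebraMap (ZMod p) F))
        (algebraMap (ZMod p) F)) x
    · intro x hx u hu
      show R.ρ (σ x) = R.ρ (σ (s u))
      rw [← hu, key x hx]
  choose r0 hr0 using hr
  have hlift : ∀ u : F, ∃ t : E, t ^ (p ^ d) - t = 0 ∧ R.ρ t = u := by
    intro u
    obtain ⟨t, ht⟩ := hfTbij.2 u
    exact ⟨t.1, t.2, congrArg Subtype.val ht⟩
  let r : (E ≃ₐ[ℚ_[p]] E) →* (F ≃ₐ[ZMod p] F) :=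
    { toFun := r0
      map_one' := by
        ext u
        obtain ⟨t, ht, htu⟩ := hlift u
        rw [← hr0 1 t (v_teich hd ht) u htu]
        exact htu
      map_mul' := by
        intro σ τ
        ext u
        obtain ⟨t, ht, htu⟩ := hlift u
        have h1 := v_teich (v := v) hd ht
        rw [← hr0 (σ * τ) t h1 u htu, AlgEquiv.mul_apply,
          hr0 σ (τ t) (by rwa [hinv]) _ (hr0 τ t h1 u htu)]
        rfl }
  have hr1 : ∀ σ, r σ = 1 ↔ ∀ t, t ^ (p ^ d) - t = 0 → σ t = t := by
    intro σ
    constructor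
    · intro h1 t ht
      apply hTinj _ _ (hσT σ t ht) ht
      have h2 := hr0 σ t (v_teich hd ht) (fT ⟨t, ht⟩) rfl
      have h3 : r0 σ = 1 := h1
      rw [h3] at h2
      exact h2
    · intro h1
      ext u
      obtain ⟨t, ht, htu⟩ := hlift u
      show ((r0 σ u : F) : κ) = u
      rw [← hr0 σ t (v_teich hd ht) u htu, h1 t ht, htu]
  let a : (E ≃ₐ[ℚ_[p]] E) → F := fun σ => fZ ⟨σ z0, hσZ σ z0 hz0⟩
  suffices key : ∃ e : (E ≃ₐ[ℚ_[p]] E) ≃* Wreath d p, ∀ σ, (e σ).right = 1 ↔ r σ = 1 by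
    obtain ⟨e, he⟩ := key
    exact ⟨e, fun σ => (he σ).trans (hr1 σ)⟩
  refine exists_wreath_equiv p hd F hFcard r a ?_ ?_ ?_ ?_
  · intro σ τ
    apply Subtype.ext
    show R.ρ (σ (τ z0) - z0) = R.ρ (σ z0 - z0) + (r0 σ (a τ) : F)
    have h1 := (hZdiff _ (hσZ τ z0 hz0)).1
    rw [← hr0 σ (τ z0 - z0) h1 (a τ) rfl, map_sub,
      ← R.map_add _ _ (hZdiff _ (hσZ σ z0 hz0)).1 (by rwa [← map_sub, hinv])]
    congr 1
    ring
  · intro σ ha hrσ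
    have hTfix := (hr1 σ).1 hrσ
    have hz0fix : σ z0 = z0 := by
      apply hZinj _ _ (hσZ σ z0 hz0) hz0
      rw [sub_self, R.map_zero]
      exact congrArg Subtype.val ha
    apply hgen σ hTfix
    intro z hz
    apply hZinj _ _ (hσZ σ z hz) hz
    have h1 := hr0 σ (z - z0) (hZdiff z hz).1 ⟨_, (hZdiff z hz).2⟩ rfl
    have h3 : r0 σ = 1 := hrσ
    rw [h3, map_sub, hz0fix] at h1
    exact h1
  · intro x
    obtain ⟨⟨z, hz⟩, hzx⟩ := hfZbij.2 x
    have hconj : IsConjRoot ℚ_[p] z z0 := by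
      rw [isConjRoot_def, gP_minpoly hv hd hz, gP_minpoly hv hd hz0]
    obtain ⟨σ, hσ⟩ := isConjRoot_iff_exists_algEquiv.1 hconj
    refine ⟨σ, ?_⟩
    rw [← hzx]
    apply Subtype.ext
    show R.ρ (σ z0 - z0) = R.ρ (z - z0)
    rw [hσ]
  · obtain ⟨g, hg⟩ := IsCyclic.exists_generator (α := Fˣ)
    obtain ⟨ζ, hζ, hζg⟩ := hlift (g : F)
    obtain ⟨φ, hφz, hφζ⟩ := exists_frob hv R hd hz0 hζ
    refine ⟨φ, ?_, ?_⟩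
    · apply Subtype.ext
      show R.ρ (φ z0 - z0) = 0
      rw [hφz, sub_self, R.map_zero]
    · have h1 : r φ (g : F) = (g : F) ^ p := by
        apply Subtype.ext
        show ((r0 φ (g : F) : F) : κ) = ((g : F) ^ p : F)
        rw [← hr0 φ ζ (v_teich hd hζ) _ hζg, hφζ, R.map_pow _ (v_teich hd hζ), hζg]
        rfl
      intro x
      by_cases hx : x = 0
      · rw [hx, map_zero, zero_pow (Fact.out : p.Prime).ne_zero]
      · obtain ⟨n, hn⟩ := mem_powers_iff_mem_zpowers.2 (hg (Units.mk0 x hx))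
        have hn' : (g : F) ^ n = x := by
          have := congrArg Units.val hn
          simpa using this
        rw [← hn', map_pow, h1, ← pow_mul, ← pow_mul, mul_comm]

end ResiduePart


section Final

open scoped NNReal

/-- the valuation on `M`. -/
noncomputable def vM (d : ℕ) : Valuation (Mp2 p d) ℝ≥0 :=
  (NormedField.valuation (K := PadicAlgCl p)).comap (algebraMap (Mp2 p d) (Qpbar p))

theorem vM_apply (d : ℕ) (x : Mp2 p d) : vM p d x = ‖(x : PadicAlgCl p)‖₊ := rfl

theorem p_ne_zero' : (p : Qpbar p) ≠ 0 := by
  have := (Fact.out : p.Prime).ne_zero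
  exact_mod_cast this

theorem root_iff {d : ℕ} (hd : 0 < d) (x : Qpbar p) :
    (X * (X + C (p : Qpbar p)) ^ (p ^ d - 1) + C (p : Qpbar p) : Polynomial (Qpbar p)).IsRoot x ↔
      (x + p ≠ 0 ∧ ((x + p)⁻¹) ^ (p ^ d) - (x + p)⁻¹ = -((p : Qpbar p)⁻¹)) := by
  have hq := q_gt (p := p) hd
  have hp := p_ne_zero' p
  obtain ⟨k, hk⟩ : ∃ k, p ^ d = k + 2 := ⟨p ^ d - 2, by omega⟩
  rw [IsRoot.def, hk]
  have h1 : k + 2 - 1 = k + 1 := by omega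
  rw [h1]
  simp only [eval_add, eval_mul, eval_X, eval_pow, eval_C]
  have key : x + p ≠ 0 → ((x + p)⁻¹) ^ (k + 2) - (x + p)⁻¹ + (p : Qpbar p)⁻¹ =
      (x * (x + p) ^ (k + 1) + p) * ((p : Qpbar p)⁻¹ * ((x + p)⁻¹) ^ (k + 2)) := by
    intro h0
    obtain ⟨y, hy⟩ : ∃ y, y = x + p := ⟨_, rfl⟩
    have hx : x = y - p := by rw [hy, add_sub_cancel_right]
    rw [← hy] at h0 ⊢
    have e1 : y ^ (k + 1) * (y⁻¹) ^ (k + 1) = 1 := by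
      rw [← mul_pow, mul_inv_cancel₀ h0, one_pow]
    have e2 : y * y⁻¹ = 1 := mul_inv_cancel₀ h0
    have e3 : (p : Qpbar p) * (p : Qpbar p)⁻¹ = 1 := mul_inv_cancel₀ hp
    rw [hx, pow_succ (y⁻¹) (k + 1)]
    generalize (y⁻¹) ^ (k + 1) = A at *
    generalize y ^ (k + 1) = B at *
    generalize y⁻¹ = C at *
    generalize (p : Qpbar p)⁻¹ = D at *
    linear_combination (-(A * C) + A * B * C) * e3 + (C - y * C * D) * e1 - D * e2
  constructor
  · intro h
    have h0 : x + p ≠ 0 := by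
      intro h0
      rw [h0, zero_pow (by omega), mul_zero, zero_add] at h
      exact hp h
    refine ⟨h0, ?_⟩
    have := key h0
    rw [h, zero_mul] at this
    exact eq_neg_of_add_eq_zero_left this
  · rintro ⟨h0, h⟩
    have h2 := key h0
    rw [h, neg_add_cancel] at h2
    exact (mul_eq_zero.1 h2.symm).resolve_right
      (mul_ne_zero (inv_ne_zero hp) (pow_ne_zero _ (inv_ne_zero h0)))

theorem teich_mem {d : ℕ} (hd : 0 < d) (t : Qpbar p) (ht : t ^ (p ^ d) - t = 0) :
    t ∈ Kur p d := by
  have hq := q_gt (p := p) hd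
  by_cases h0 : t = 0
  · rw [h0]
    exact zero_mem _
  · apply IntermediateField.subset_adjoin
    show t ^ (p ^ d - 1) = 1
    apply mul_right_cancel₀ h0
    rw [← pow_succ, Nat.sub_add_cancel (by omega), one_mul, sub_eq_zero.1 ht]

theorem Kur_le {d : ℕ} : Kur p d ≤ Mp2 p d := by
  intro x hx
  exact IntermediateField.algebraMap_mem
    (IntermediateField.adjoin (Kur p d)
    {x : Qpbar p | (X * (X + C (p : Qpbar p)) ^ (p ^ d - 1) + C (p : Qpbar p) :
      Polynomial (Qpbar p)).IsRoot x}) (⟨x, hx⟩ : Kur p d)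

theorem z_mem {d : ℕ} (hd : 0 < d) (z : Qpbar p)
    (hz : z ^ (p ^ d) - z = -((p : Qpbar p)⁻¹)) : z ∈ Mp2 p d := by
  have hp := p_ne_zero' p
  have hz0 : z ≠ 0 := by
    rintro rfl
    rw [zero_pow (pow_ne_zero _ (Fact.out : p.Prime).ne_zero), sub_zero, eq_comm, neg_eq_zero] at hz
    exact inv_ne_zero hp hz
  have h1 : z⁻¹ - p ∈ Mp2 p d := by
    have : (X * (X + C (p : Qpbar p)) ^ (p ^ d - 1) + C (p : Qpbar p) :
      Polynomial (Qpbar p)).IsRoot (z⁻¹ - p) := by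
      rw [root_iff p hd, sub_add_cancel, inv_inv]
      exact ⟨inv_ne_zero hz0, hz⟩
    exact IntermediateField.subset_adjoin (Kur p d) _ this
  have h2 : z⁻¹ ∈ Mp2 p d := by
    have := add_mem h1 (_root_.natCast_mem (Mp2 p d) p)
    rwa [sub_add_cancel] at this
  have := inv_mem h2
  rwa [inv_inv] at this

/-- `M` as generated by the two sets. -/
theorem Mp2_le {d : ℕ} (hd : 0 < d) (N : IntermediateField ℚ_[p] (Qpbar p))
    (h1 : ∀ t : Qpbar p, t ^ (p ^ d) - t = 0 → t ∈ N)
    (h2 : ∀ z : Qpbar p, z ^ (p ^ d) - z = -((p : Qpbar p)⁻¹) → z ∈ N) : Mp2 p d ≤ N := by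
  have hq := q_gt (p := p) hd
  have hK : Kur p d ≤ N := by
    rw [Kur, IntermediateField.adjoin_le_iff]
    intro t ht
    apply h1
    have ht' : t ^ (p ^ d - 1) = 1 := ht
    rw [← Nat.sub_add_cancel (show 1 ≤ p ^ d by omega), pow_succ, ht', one_mul, sub_self]
  let N' : IntermediateField (Kur p d) (Qpbar p) := IntermediateField.extendScalars hK
  have : IntermediateField.adjoin (Kur p d)
    {x : Qpbar p | (X * (X + C (p : Qpbar p)) ^ (p ^ d - 1) + C (p : Qpbar p) :
      Polynomial (Qpbar p)).IsRoot x} ≤ N' := by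
    rw [IntermediateField.adjoin_le_iff]
    intro x hx
    obtain ⟨-, h4⟩ := (root_iff p hd x).1 hx
    have h5 : x + p ∈ N := by
      have := inv_mem (h2 _ h4)
      rwa [inv_inv] at this
    have h6 := sub_mem h5 (_root_.natCast_mem N p)
    rw [add_sub_cancel_right] at h6
    exact h6
  intro x hx
  exact this hx

theorem Mp2_normal {d : ℕ} (hd : 0 < d) : Normal ℚ_[p] (Mp2 p d) := by
  rw [IntermediateField.normal_iff_forall_map_le']
  intro σ
  rw [IntermediateField.map_le_iff_le_comap]
  apply Mp2_le p hd
  · intro t ht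
    apply Kur_le
    apply teich_mem p hd
    show (σ t) ^ (p ^ d) - σ t = 0
    rw [← map_pow, ← map_sub, ht, map_zero]
  · intro z hz
    apply z_mem p hd
    show (σ z) ^ (p ^ d) - σ z = _
    rw [← map_pow, ← map_sub, hz]
    simp

theorem splits_of_mem {d : ℕ} (hd : 0 < d) (c : Mp2 p d)
    (h : ∀ z : Qpbar p, z ^ (p ^ d) - z = c → z ∈ Mp2 p d) :
    (X ^ (p ^ d) - X - C c : (Mp2 p d)[X]).Splits := by
  have hq := q_gt (p := p) hd
  have hs : ((X ^ (p ^ d) - X - C c : (Mp2 p d)[X]).map (algebraMap (Mp2 p d) (Qpbar p))).Splits :=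
    IsAlgClosed.splits _
  refine Polynomial.Splits.of_splits_map (algebraMap (Mp2 p d) (Qpbar p)) hs ?_
  intro a ha
  have hm := (asp_monic hq c).map (algebraMap (Mp2 p d) (Qpbar p))
  rw [mem_roots hm.ne_zero, IsRoot.def] at ha
  refine ⟨⟨a, h a ?_⟩, rfl⟩
  have ha' : a ^ (p ^ d) - a - (c : Qpbar p) = 0 := by
    simpa using ha
  exact sub_eq_zero.1 ha'

theorem mem_fixed_zpowers {d : ℕ} (σ : Mp2 p d ≃ₐ[ℚ_[p]] Mp2 p d) (x : Mp2 p d) :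
    x ∈ IntermediateField.fixedField (Subgroup.zpowers σ) ↔ σ x = x := by
  rw [IntermediateField.mem_fixedField_iff]
  constructor
  · intro h
    exact h σ (Subgroup.mem_zpowers σ)
  · intro h f hf
    have : Subgroup.zpowers σ ≤ MulAction.stabilizer (Mp2 p d ≃ₐ[ℚ_[p]] Mp2 p d) x := by
      rw [Subgroup.zpowers_le]
      exact h
    exact this hf

theorem main_final (d : ℕ) (hd : 0 < d) :
    ∃ e : (Mp2 p d ≃ₐ[ℚ_[p]] Mp2 p d) ≃* Wreath d p,
      Subgroup.map e.toMonoidHom (fixKur p d) = SemidirectProduct.inl.range := by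
  have hq := q_gt (p := p) hd
  have hN := Mp2_normal p hd
  have hv : ∀ a : ℚ_[p], vM p d (algebraMap _ _ a) = ‖a‖₊ := by
    intro a
    rw [vM_apply]
    ext
    exact PadicAlgCl.norm_extends p a
  have hinv : ∀ (σ : Mp2 p d ≃ₐ[ℚ_[p]] Mp2 p d) x, vM p d (σ x) = vM p d x := by
    intro σ x
    rw [vM_apply, vM_apply]
    ext
    have h1 := σ.liftNormal_commutes (Qpbar p) x
    have h2 := spectralNorm_eq_of_equiv (K := ℚ_[p]) (σ.liftNormal (Qpbar p))
      (algebraMap (Mp2 p d) (Qpbar p) x)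
    rw [h1] at h2
    exact h2.symm
  obtain ⟨e, he⟩ := main_abstract hv hinv hd
    (splits_of_mem p hd 0 (fun z hz => Kur_le p (teich_mem p hd z (by simpa using hz))))
    (splits_of_mem p hd _ (fun z hz => z_mem p hd z (by simpa using hz)))
    (by
      intro σ h1 h2
      let N : IntermediateField ℚ_[p] (Mp2 p d) := IntermediateField.fixedField
        (Subgroup.zpowers σ)
      have hfix := mem_fixed_zpowers p σ
      have hle : Mp2 p d ≤ IntermediateField.lift N := by
        apply Mp2_le p hd
        · intro t ht
          have htM := Kur_le p (teich_mem p hd t ht)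
          refine (IntermediateField.mem_lift (⟨t, htM⟩ : Mp2 p d)).2 ?_
          rw [hfix]
          exact h1 _ (Subtype.ext ht)
        · intro t ht
          have htM := z_mem p hd t ht
          refine (IntermediateField.mem_lift (⟨t, htM⟩ : Mp2 p d)).2 ?_
          rw [hfix]
          apply h2
          apply Subtype.ext
          simpa using ht
      ext x
      have h3 := (IntermediateField.mem_lift x).1 (hle x.2)
      rw [hfix] at h3
      rw [h3]
      rfl)
  refine ⟨e, ?_⟩
  have hker : ∀ σ, σ ∈ fixKur p d ↔ (e σ).right = 1 := by
    intro σ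
    rw [he]
    constructor
    · intro h t ht
      exact h t (teich_mem p hd t (by simpa using congrArg Subtype.val ht))
    · intro h x hx
      have hfix := mem_fixed_zpowers p σ
      have hle : Kur p d ≤ IntermediateField.lift
          (IntermediateField.fixedField (Subgroup.zpowers σ)) := by
        rw [Kur, IntermediateField.adjoin_le_iff]
        intro t ht
        have ht' : t ^ (p ^ d - 1) = 1 := ht
        have ht2 : t ^ (p ^ d) - t = 0 := by
          rw [← Nat.sub_add_cancel (show 1 ≤ p ^ d by omega), pow_succ, ht', one_mul, sub_self]
        have htM := Kur_le p (teich_mem p hd t ht2)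
        refine (IntermediateField.mem_lift (⟨t, htM⟩ : Mp2 p d)).2 ?_
        rw [hfix]
        exact h _ (Subtype.ext ht2)
      exact (hfix x).1 ((IntermediateField.mem_lift x).1 (hle hx))
  ext w
  rw [SemidirectProduct.range_inl_eq_ker_rightHom, MonoidHom.mem_ker, Subgroup.mem_map]
  constructor
  · rintro ⟨σ, hσ, rfl⟩
    exact (hker σ).1 hσ
  · intro hw
    refine ⟨e.symm w, (hker _).2 ?_, e.apply_symm_apply w⟩
    rw [e.apply_symm_apply]
    exact hw

end Final


/-- there is a group isomorphism from `Gal(M_{p,2}/ℚ_p)` onto the regular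
wreath product `C_p ≀ C_d = (ℤ/dℤ → ℤ/pℤ) ⋊ ℤ/dℤ` (with `ℤ/dℤ` acting by translation of
the argument), which carries the subgroup `Gal(M_{p,2}/K)` onto the base group of
functions `ℤ/dℤ → ℤ/pℤ`. -/
theorem statement8 (hp : Odd p) (d : ℕ) (hd : 0 < d) :
    ∃ e : (Mp2 p d ≃ₐ[ℚ_[p]] Mp2 p d) ≃* Wreath d p,
      Subgroup.map e.toMonoidHom (fixKur p d) = SemidirectProduct.inl.range := by
  exact main_final p d hd
end

section
/- Let η ∈ μ_{q−1} be such that its reduction η̄ ∈ k generates a normal basis of k over 𝔽_p, i.e. η̄, η̄^p, …, η̄^{p^{d−1}} is an 𝔽_p-basis of k. Then one has the internal direct sum decompositions of ℤ_p-modules O_K = η·ℤ_p ⊕ ⨁_{i=1}^{d−1}(η^{p^i} − η^{p^{i+1}})·ℤ_p and Z = p·η·ℤ_p ⊕ ⨁_{i=1}^{d−1}(η^{p^i} − η^{p^{i+1}})·ℤ_p. -/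
open Polynomial Filter IntermediateField

variable (p : ℕ) [Fact p.Prime]

/-- The canonical map `ℤ_p → K`. -/
noncomputable def zpToK (d : ℕ) (t : ℤ_[p]) : Kur p d :=
  algebraMap ℚ_[p] (Kur p d) (t : ℚ_[p])


theorem exists_residue {L : Type} [Field L] (abv : AbsoluteValue L ℝ)
    (hna : IsNonarchimedean abv) :
    ∃ (F : Type) (_ : Field F) (O : Subring L) (π : O →+* F),
      (∀ x, x ∈ O ↔ abv x ≤ 1) ∧ (∀ x : O, π x = 0 ↔ abv (x : L) < 1) := by
  let v : Valuation L NNReal :=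
    { toFun := fun x => Real.toNNReal (abv x)
      map_zero' := by simp
      map_one' := by simp
      map_mul' := fun x y => by
        rw [map_mul, Real.toNNReal_mul (abv.nonneg x)]
      map_add_le_max' := fun x y => by
        rcases le_max_iff.mp (hna x y) with h | h
        · exact le_max_of_le_left (Real.toNNReal_le_toNNReal h)
        · exact le_max_of_le_right (Real.toNNReal_le_toNNReal h) }
  refine ⟨IsLocalRing.ResidueField v.valuationSubring, inferInstance,
    v.valuationSubring.toSubring, IsLocalRing.residue v.valuationSubring, ?_, ?_⟩
  · intro x
    change v x ≤ 1 ↔ _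
    exact Real.toNNReal_le_one
  · intro x
    refine (IsLocalRing.residue_eq_zero_iff (R := v.valuationSubring) x).trans ?_
    refine (ValuationSubring.valuation_lt_one_iff v.valuationSubring x).trans ?_
    rw [(Valuation.isEquiv_iff_val_lt_one.mp (Valuation.isEquiv_valuation_valuationSubring v)).symm]
    exact Real.toNNReal_lt_one

theorem gal_inv (p : ℕ) [Fact p.Prime] {L : Type*} [Field L] [Algebra ℚ_[p] L]
    [Algebra.IsAlgebraic ℚ_[p] L] (abv : AbsoluteValue L ℝ)
    (habv : ∀ x : ℚ_[p], abv (algebraMap ℚ_[p] L x) = ‖x‖) (σ : L ≃ₐ[ℚ_[p]] L) (x : L) :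
    abv (σ x) = abv x := by
  rw [spectralNorm_unique_field_norm_ext habv, spectralNorm_unique_field_norm_ext habv,
    ← spectralNorm_eq_of_equiv]

theorem abv_na (p : ℕ) [Fact p.Prime] {L : Type*} [Field L] [Algebra ℚ_[p] L]
    [Algebra.IsAlgebraic ℚ_[p] L] (abv : AbsoluteValue L ℝ)
    (habv : ∀ x : ℚ_[p], abv (algebraMap ℚ_[p] L x) = ‖x‖) : IsNonarchimedean abv := by
  intro x y
  simp only [spectralNorm_unique_field_norm_ext habv]
  exact isNonarchimedean_spectralNorm x y

/-- The norm of a combination dominates the coefficients. -/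
theorem coeff_le (p : ℕ) [Fact p.Prime] {L : Type*} [Field L] [Algebra ℚ_[p] L]
    (abv : AbsoluteValue L ℝ)
    (habv : ∀ x : ℚ_[p], abv (algebraMap ℚ_[p] L x) = ‖x‖) {d : ℕ} (e : Fin d → L)
    (hnb : ∀ c : Fin d → ℤ_[p],
      abv (∑ i, algebraMap ℚ_[p] L (c i) * e i) < 1 → ∀ i, ‖c i‖ < 1)
    (c : Fin d → ℚ_[p]) (j : Fin d) : ‖c j‖ ≤ abv (∑ i, algebraMap ℚ_[p] L (c i) * e i) := by
  obtain ⟨m, -, hm⟩ := Finset.exists_max_image Finset.univ (fun i => ‖c i‖) ⟨j, Finset.mem_univ j⟩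
  refine (hm j (Finset.mem_univ j)).trans ?_
  by_contra! hlt
  have h0 : 0 < ‖c m‖ := (abv.nonneg _).trans_lt hlt
  have hc0 : c m ≠ 0 := norm_pos_iff.mp h0
  have hle : ∀ i, ‖c i / c m‖ ≤ 1 := fun i => by
    rw [norm_div, div_le_one h0]; exact hm i (Finset.mem_univ i)
  have := hnb (fun i => ⟨c i / c m, hle i⟩) (by
    have : ∑ i, algebraMap ℚ_[p] L (c i / c m) * e i =
        algebraMap ℚ_[p] L (c m)⁻¹ * ∑ i, algebraMap ℚ_[p] L (c i) * e i := by
      rw [Finset.mul_sum]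
      refine Finset.sum_congr rfl fun i _ => ?_
      rw [div_eq_mul_inv, map_mul]; ring
    change abv (∑ i, algebraMap ℚ_[p] L (c i / c m) * e i) < 1
    rw [this, map_mul, habv, norm_inv, inv_mul_lt_one₀ h0]
    exact hlt) m
  change ‖c m / c m‖ < 1 at this
  rw [div_self hc0] at this
  simp at this

theorem lin_indep (p : ℕ) [Fact p.Prime] {L : Type*} [Field L] [Algebra ℚ_[p] L]
    (abv : AbsoluteValue L ℝ)
    (habv : ∀ x : ℚ_[p], abv (algebraMap ℚ_[p] L x) = ‖x‖) {d : ℕ} (e : Fin d → L)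
    (hnb : ∀ c : Fin d → ℤ_[p],
      abv (∑ i, algebraMap ℚ_[p] L (c i) * e i) < 1 → ∀ i, ‖c i‖ < 1) :
    LinearIndependent ℚ_[p] e := by
  rw [Fintype.linearIndependent_iff]
  intro c hc j
  have := coeff_le p abv habv e hnb c j
  simp only [← Algebra.smul_def, hc, map_zero] at this
  exact norm_le_zero_iff.mp this

theorem core_inj {p d : ℕ} [Fact p.Prime] (hd : 0 < d) {O F : Type*} [CommRing O] [IsDomain O]
    [Field F] [CharP F p] (π : O →+* F) {x y : O} (hx : x ^ (p ^ d - 1) = 1)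
    (hy : y ^ (p ^ d - 1) = 1) (h : π x = π y) : x = y := by
  by_contra hne
  have hp1 : 1 < p ^ d := Nat.one_lt_pow hd.ne' (Fact.out : p.Prime).one_lt
  have h1 := geom_sum₂_mul x y (p ^ d - 1)
  rw [hx, hy, sub_self, mul_eq_zero, or_iff_left (sub_ne_zero.mpr hne)] at h1
  have h2 := congrArg π h1
  simp only [map_sum, map_mul, map_pow, h, map_zero] at h2
  have h3 : ∀ i ∈ Finset.range (p ^ d - 1), π y ^ i * π y ^ (p ^ d - 1 - 1 - i) =
      π y ^ (p ^ d - 1 - 1) := by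
    intro i hi
    rw [Finset.mem_range] at hi
    rw [← pow_add]; congr 1; omega
  rw [Finset.sum_congr rfl h3, Finset.sum_const, Finset.card_range, nsmul_eq_mul,
    Nat.cast_sub hp1.le, Nat.cast_pow, CharP.cast_eq_zero, zero_pow hd.ne'] at h2
  have h4 : π y ^ (p ^ d - 1) = 1 := by rw [← map_pow, hy, map_one]
  have h5 : π y ≠ 0 := by
    intro h0
    rw [h0, zero_pow (by omega)] at h4
    exact zero_ne_one h4
  have := pow_ne_zero (p ^ d - 1 - 1) h5
  simp [this] at h2

theorem pow_q {p d : ℕ} [Fact p.Prime] {O : Type*} [CommRing O] {x : O}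
    (hx : x ^ (p ^ d - 1) = 1) : x ^ p ^ d = x := by
  have hp1 : 0 < p ^ d := pow_pos (Fact.out : p.Prime).pos d
  have : p ^ d = (p ^ d - 1) + 1 := by omega
  rw [this, pow_succ, hx, one_mul]

theorem core_conj {p d : ℕ} [Fact p.Prime] (hd : 0 < d) {O F : Type*} [CommRing O] [IsDomain O]
    [Field F] [CharP F p] (π : O →+* F) (σ : O →+* O) (hσ : ∀ x, π x = 0 → π (σ x) = 0)
    {η : O} (hη : η ^ (p ^ d - 1) = 1) : ∃ i : Fin d, σ η = η ^ p ^ (i : ℕ) := by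
  let P : F[X] := ∏ i ∈ Finset.range d, (X - C (π η ^ p ^ i))
  have hP : P.map (frobenius F p) = P := by
    simp only [P, Polynomial.map_prod, Polynomial.map_sub, map_X, map_C, frobenius_def, ← pow_mul,
      ← pow_succ]
    obtain ⟨m, rfl⟩ : ∃ m, d = m + 1 := ⟨d - 1, by omega⟩
    rw [Finset.prod_range_succ, Finset.prod_range_succ' _ m]
    congr 2
    rw [← map_pow, pow_q hη, pow_zero, pow_one]
  have hl : P ∈ lifts (Int.castRingHom F) := by
    rw [lifts_iff_coeff_lifts]
    intro n
    have : P.coeff n ^ p = P.coeff n := by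
      conv_rhs => rw [← hP, coeff_map, frobenius_def]
    rw [← Subfield.mem_bot_iff_pow_eq_self F p, ← ZMod.fieldRange_castHom_eq_bot p] at this
    obtain ⟨z, hz⟩ := this
    refine ⟨z.val, ?_⟩
    rw [← hz, eq_intCast, Int.cast_natCast, ← map_natCast (ZMod.castHom (dvd_refl p) F),
      ZMod.natCast_zmod_val]
  obtain ⟨H, hH⟩ := (mem_lifts _).mp hl
  have key : ∀ x : O, π (H.eval₂ (Int.castRingHom O) x) = P.eval (π x) := by
    intro x
    rw [hom_eval₂, ← hH, eval_map]
    congr 1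
    exact RingHom.ext_int _ _
  have h1 : π (H.eval₂ (Int.castRingHom O) η) = 0 := by
    rw [key]
    simp only [P, eval_prod]
    exact Finset.prod_eq_zero (Finset.mem_range.mpr hd) (by simp)
  have h2 := hσ _ h1
  rw [hom_eval₂, show σ.comp (Int.castRingHom O) = Int.castRingHom O from RingHom.ext_int _ _,
    key] at h2
  simp only [P, eval_prod, Finset.prod_eq_zero_iff, eval_sub, eval_X, eval_C, sub_eq_zero] at h2
  obtain ⟨i, hi, h3⟩ := h2
  refine ⟨⟨i, Finset.mem_range.mp hi⟩, core_inj (p := p) hd π ?_ ?_ (by simpa using h3)⟩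
  · rw [← map_pow, hη, map_one]
  · rw [← pow_mul, mul_comm, pow_mul, hη, one_pow]

theorem core_fix {p d : ℕ} [Fact p.Prime] (hd : 0 < d) {O F : Type*} [CommRing O] [IsDomain O]
    [Field F] [CharP F p] [Algebra (ZMod p) F]
    (π : O →+* F) (σ : O →+* O) (hσ : ∀ x, π x = 0 → π (σ x) = 0)
    {η : O} (hη : η ^ (p ^ d - 1) = 1)
    (hli : LinearIndependent (ZMod p) (fun i : Fin d => π η ^ p ^ (i : ℕ)))
    (hfix : σ η = η) {x : O} (hx : x ^ (p ^ d - 1) = 1) : σ x = x := by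
  classical
  have hp1 : 1 < p ^ d := Nat.one_lt_pow hd.ne' (Fact.out : p.Prime).one_lt
  let g : (Fin d → ZMod p) → F := fun c => ∑ i, c i • π η ^ p ^ (i : ℕ)
  have hg : Function.Injective g := by
    intro a b hab
    have h1 := Fintype.linearIndependent_iff.mp hli (a - b) (by
      simp only [Pi.sub_apply, sub_smul, Finset.sum_sub_distrib]
      exact sub_eq_zero.mpr hab)
    exact funext fun i => sub_eq_zero.mp (h1 i)
  let S : Finset F := Finset.univ.image g
  have hS : S.card = p ^ d := by
    rw [Finset.card_image_of_injective _ hg]; simp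
  have hne : (X ^ p ^ d - X : F[X]) ≠ 0 := FiniteField.X_pow_card_sub_X_ne_zero F hp1
  let R : Finset F := (X ^ p ^ d - X : F[X]).roots.toFinset
  have hR : R.card ≤ p ^ d := by
    refine (Multiset.toFinset_card_le _).trans ((card_roots' _).trans ?_)
    rw [FiniteField.X_pow_card_sub_X_natDegree_eq F hp1]
  have hmem : ∀ y, y ∈ R ↔ y ^ p ^ d = y := by
    intro y
    simp [R, hne, sub_eq_zero]
  have hSR : S ⊆ R := by
    intro y hy
    obtain ⟨c, -, rfl⟩ := Finset.mem_image.mp hy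
    rw [hmem]
    simp only [g]
    rw [sum_pow_char_pow]
    refine Finset.sum_congr rfl fun i _ => ?_
    rw [_root_.smul_pow, ZMod.pow_card_pow, ← pow_mul, mul_comm, pow_mul, ← map_pow π η (p ^ d), pow_q hη]
  have hEq : S = R := Finset.eq_of_subset_of_card_le hSR (by omega)
  have hxR : π x ∈ S := by
    rw [hEq, hmem, ← map_pow, pow_q hx]
  obtain ⟨c, -, hc⟩ := Finset.mem_image.mp hxR
  let y : O := ∑ i : Fin d, ((c i).val : O) * η ^ p ^ (i : ℕ)
  have hy : π y = π x := by
    rw [← hc]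
    simp only [y, g, map_sum, map_mul, map_natCast, map_pow]
    refine Finset.sum_congr rfl fun i _ => ?_
    rw [Algebra.smul_def, ← map_natCast (algebraMap (ZMod p) F), ZMod.natCast_zmod_val]
  have hσy : σ y = y := by
    simp only [y, map_sum, map_mul, map_natCast, map_pow, hfix]
  have h1 := hσ (y - x) (by rw [map_sub, hy, sub_self])
  rw [map_sub, hσy, map_sub, hy, sub_eq_zero] at h1
  refine core_inj (p := p) hd π ?_ hx h1.symm
  rw [← map_pow, hx, map_one]

theorem gal_main (p : ℕ) [Fact p.Prime] {d : ℕ} (hd : 0 < d) {L : Type} [Field L]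
    [Algebra ℚ_[p] L] [FiniteDimensional ℚ_[p] L] [IsGalois ℚ_[p] L]
    (hgen : IntermediateField.adjoin ℚ_[p] {x : L | x ^ (p ^ d - 1) = 1} = ⊤)
    (abv : AbsoluteValue L ℝ)
    (habv : ∀ x : ℚ_[p], abv (algebraMap ℚ_[p] L x) = ‖x‖)
    (η : L) (hη : η ^ (p ^ d - 1) = 1)
    (hnb : ∀ c : Fin d → ℤ_[p],
      abv (∑ i : Fin d, algebraMap ℚ_[p] L (c i) * η ^ p ^ (i : ℕ)) < 1 → ∀ i, ‖c i‖ < 1) :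
    Module.finrank ℚ_[p] L = d ∧
    ∀ j : ℕ, algebraMap ℚ_[p] L (Algebra.trace ℚ_[p] L (η ^ p ^ j)) =
      ∑ i : Fin d, η ^ p ^ (i : ℕ) := by
  classical
  have hpp : p.Prime := Fact.out
  have hp1 : 1 < p ^ d := Nat.one_lt_pow hd.ne' hpp.one_lt
  have hn0 : p ^ d - 1 ≠ 0 := by omega
  obtain ⟨F, _, O, π, hO, hπ⟩ := exists_residue abv (abv_na p abv habv)
  have habvp : abv (p : L) < 1 := by
    have := habv (p : ℚ_[p])
    rw [map_natCast] at this
    rw [this]; exact Padic.norm_p_lt_one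
  have : CharP F p := by
    have h0 : ((p : ℕ) : F) = 0 := by
      rw [← map_natCast π, hπ]
      simpa using habvp
    exact (CharP.charP_iff_prime_eq_zero hpp).mpr h0
  let _ : Algebra (ZMod p) F := ZMod.algebra F p
  have hmu : ∀ x : L, x ^ (p ^ d - 1) = 1 → x ∈ O := by
    intro x hx
    rw [hO]
    have h1 : abv x ^ (p ^ d - 1) = 1 := by rw [← map_pow, hx, map_one]
    exact ((pow_eq_one_iff_of_nonneg (abv.nonneg x) hn0).mp h1).le
  let ηO : O := ⟨η, hmu η hη⟩
  have hηO : ηO ^ (p ^ d - 1) = 1 := Subtype.ext hη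
  let σO : (L ≃ₐ[ℚ_[p]] L) → (O →+* O) := fun σ =>
    ((σ : L →+* L).comp O.subtype).codRestrict O (fun x => by
      have := (hO x).mp x.2
      rw [hO]
      simpa [gal_inv p abv habv σ] using this)
  have hσO : ∀ σ (x : O), ((σO σ x : O) : L) = σ x := fun σ x => rfl
  have hker : ∀ σ (x : O), π x = 0 → π (σO σ x) = 0 := by
    intro σ x hx
    rw [hπ] at hx ⊢
    rw [hσO, gal_inv p abv habv]; exact hx
  have hli : LinearIndependent (ZMod p) (fun i : Fin d => π ηO ^ p ^ (i : ℕ)) := by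
    rw [Fintype.linearIndependent_iff]
    intro c hc j
    have h1 : π (∑ i : Fin d, ((c i).val : O) * ηO ^ p ^ (i : ℕ)) = 0 := by
      rw [← hc]
      simp only [map_sum, map_mul, map_natCast, map_pow]
      refine Finset.sum_congr rfl fun i _ => ?_
      rw [Algebra.smul_def, ← map_natCast (algebraMap (ZMod p) F), ZMod.natCast_zmod_val]
    rw [hπ] at h1
    have h2 := hnb (fun i => ((c i).val : ℤ_[p])) (by
      convert h1 using 2
      rw [AddSubmonoidClass.coe_finsetSum]
      refine Finset.sum_congr rfl fun i _ => ?_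
      simp only [PadicInt.coe_natCast, map_natCast, Subring.coe_mul, Subring.coe_natCast,
        Subring.coe_pow]
      rfl) j
    have h3 : p ∣ (c j).val := by
      have := (PadicInt.norm_int_lt_one_iff_dvd (p := p) ((c j).val : ℤ)).mp (by simpa using h2)
      exact_mod_cast this
    rw [← ZMod.natCast_zmod_val (c j)]
    exact (ZMod.natCast_eq_zero_iff _ _).mpr h3
  have hconj : ∀ σ : L ≃ₐ[ℚ_[p]] L, ∃ i : Fin d, σ η = η ^ p ^ (i : ℕ) := by
    intro σ
    obtain ⟨i, hi⟩ := core_conj (p := p) hd π (σO σ) (hker σ) hηO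
    exact ⟨i, congrArg (Subtype.val) hi⟩
  choose ι hι using hconj
  have hfix : ∀ σ : L ≃ₐ[ℚ_[p]] L, σ η = η → σ = 1 := by
    intro σ hσ
    have h1 : ∀ x : L, x ^ (p ^ d - 1) = 1 → σ x = x := by
      intro x hx
      have := core_fix (p := p) hd π (σO σ) (hker σ) hηO hli (Subtype.ext hσ)
        (x := ⟨x, hmu x hx⟩) (Subtype.ext hx)
      exact congrArg (Subtype.val) this
    have h2 : (⊤ : IntermediateField ℚ_[p] L) ≤
        IntermediateField.fixedField (Subgroup.zpowers σ) := by
      rw [← hgen, IntermediateField.adjoin_le_iff]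
      intro x hx
      rw [SetLike.mem_coe, IntermediateField.mem_fixedField_iff]
      intro g hg
      rw [Subgroup.mem_zpowers_iff] at hg
      obtain ⟨k, rfl⟩ := hg
      have : σ ∈ MulAction.stabilizer (L ≃ₐ[ℚ_[p]] L) x := h1 x hx
      exact Subgroup.zpow_mem _ this k
    ext x
    have := h2 (show x ∈ (⊤ : IntermediateField ℚ_[p] L) from trivial)
    rw [IntermediateField.mem_fixedField_iff] at this
    exact this σ (Subgroup.mem_zpowers σ)
  have hinj : Function.Injective ι := by
    intro σ τ h
    have h1 : σ η = τ η := by rw [hι, hι, h]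
    have h2 := hfix (τ⁻¹ * σ) (by
      rw [AlgEquiv.mul_apply, h1]
      exact τ.symm_apply_apply η)
    exact (inv_mul_eq_one.mp h2).symm
  have hcard : Fintype.card (L ≃ₐ[ℚ_[p]] L) = Module.finrank ℚ_[p] L := by
    rw [Fintype.card_eq_nat_card]; exact IsGalois.card_aut_eq_finrank _ _
  have hle : Module.finrank ℚ_[p] L ≤ d := by
    rw [← hcard]; simpa using Fintype.card_le_of_injective ι hinj
  have hge : d ≤ Module.finrank ℚ_[p] L := by
    simpa using (lin_indep p abv habv _ hnb).fintype_card_le_finrank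
  have hfr := le_antisymm hle hge
  refine ⟨hfr, ?_⟩
  have hbij : Function.Bijective ι :=
    (Fintype.bijective_iff_injective_and_card ι).mpr ⟨hinj, by rw [hcard, hfr]; simp⟩
  have hsum : ∀ j : ℕ, algebraMap ℚ_[p] L (Algebra.trace ℚ_[p] L (η ^ p ^ j)) =
      ∑ i : Fin d, (η ^ p ^ j) ^ p ^ (i : ℕ) := by
    intro j
    rw [trace_eq_sum_automorphisms]
    refine Fintype.sum_bijective ι hbij _ _ fun σ => ?_
    rw [map_pow, hι, ← pow_mul, ← pow_mul, mul_comm]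
  intro j
  rw [hsum]
  induction j with
  | zero => simp
  | succ j ih =>
    rw [← ih, Fin.sum_univ_eq_sum_range (fun i => (η ^ p ^ (j + 1)) ^ p ^ i),
      Fin.sum_univ_eq_sum_range (fun i => (η ^ p ^ j) ^ p ^ i)]
    obtain ⟨m, rfl⟩ : ∃ m, d = m + 1 := ⟨d - 1, by omega⟩
    rw [Finset.sum_range_succ, Finset.sum_range_succ' _ m]
    congr 1
    · refine Finset.sum_congr rfl fun i _ => ?_
      rw [← pow_mul, ← pow_mul]; ring_nf
    · rw [pow_zero, pow_one, ← pow_mul, ← pow_add,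
        show j + 1 + m = (m + 1) + j by ring, pow_add, pow_mul, pow_q hη]

theorem abv_sum_le (p : ℕ) [Fact p.Prime] {L : Type} [Field L]
    [Algebra ℚ_[p] L] (abv : AbsoluteValue L ℝ) (hna : IsNonarchimedean abv)
    (habv : ∀ x : ℚ_[p], abv (algebraMap ℚ_[p] L x) = ‖x‖) {d : ℕ} (f : Fin d → L)
    (hf : ∀ i, abv (f i) ≤ 1) (c : Fin d → ℤ_[p]) :
    abv (∑ i, algebraMap ℚ_[p] L (c i) * f i) ≤ 1 := by
  obtain ⟨F, _, O, π, hO, -⟩ := exists_residue abv hna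
  rw [← hO]
  refine Subring.sum_mem _ fun i _ => Subring.mul_mem _ ?_ ((hO _).mpr (hf i))
  rw [hO, habv]
  exact (c i).norm_le_one

/-- The linear algebra of the statement, for an abstract family. -/
theorem lin_main (p : ℕ) [Fact p.Prime] {d : ℕ} (hd : 0 < d) {L : Type} [Field L]
    [Algebra ℚ_[p] L] [FiniteDimensional ℚ_[p] L] (hfr : Module.finrank ℚ_[p] L = d)
    (abv : AbsoluteValue L ℝ) (hna : IsNonarchimedean abv)
    (habv : ∀ x : ℚ_[p], abv (algebraMap ℚ_[p] L x) = ‖x‖)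
    (e : ℕ → L) (hper : e d = e 0) (he : ∀ i, abv (e i) ≤ 1)
    (hnb : ∀ c : Fin d → ℤ_[p],
      abv (∑ i : Fin d, algebraMap ℚ_[p] L (c i) * e i) < 1 → ∀ i, ‖c i‖ < 1)
    (htr : ∀ i, algebraMap ℚ_[p] L (Algebra.trace ℚ_[p] L (e i)) = ∑ i : Fin d, e i)
    (f g : Fin d → L) (hf0 : ∀ i : Fin d, (i : ℕ) = 0 → f i = e 0)
    (hf : ∀ i : Fin d, (i : ℕ) ≠ 0 → f i = e i - e (i + 1))
    (hg0 : ∀ i : Fin d, (i : ℕ) = 0 → g i = p * f i)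
    (hg : ∀ i : Fin d, (i : ℕ) ≠ 0 → g i = f i) :
    ((∀ c : Fin d → ℤ_[p], abv (∑ i : Fin d, algebraMap ℚ_[p] L (c i) * f i) ≤ 1) ∧
      (∀ x : L, abv x ≤ 1 →
        ∃! c : Fin d → ℤ_[p], x = ∑ i : Fin d, algebraMap ℚ_[p] L (c i) * f i)) ∧
    ((∀ c : Fin d → ℤ_[p], abv (∑ i : Fin d, algebraMap ℚ_[p] L (c i) * g i) ≤ 1 ∧
        ‖Algebra.trace ℚ_[p] L (∑ i : Fin d, algebraMap ℚ_[p] L (c i) * g i)‖ ≤ (p : ℝ)⁻¹) ∧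
      (∀ x : L, abv x ≤ 1 → ‖Algebra.trace ℚ_[p] L x‖ ≤ (p : ℝ)⁻¹ →
        ∃! c : Fin d → ℤ_[p], x = ∑ i : Fin d, algebraMap ℚ_[p] L (c i) * g i)) := by
  classical
  have hp0 : (p : ℚ_[p]) ≠ 0 := Nat.cast_ne_zero.mpr (Fact.out : p.Prime).ne_zero
  let z : Fin d := ⟨0, hd⟩
  have hz : ∀ i : Fin d, (i : ℕ) = 0 ↔ i = z := fun i => by simp [z, Fin.ext_iff]
  -- the norms of the generators
  have hfle : ∀ i, abv (f i) ≤ 1 := by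
    intro i
    by_cases hi : (i : ℕ) = 0
    · rw [hf0 i hi]; exact he 0
    · rw [hf i hi, sub_eq_add_neg]
      refine (hna _ _).trans (max_le (he _) ?_)
      rw [abv.map_neg]; exact he _
  -- the e-basis
  have hli := lin_indep p abv habv _ hnb
  have hspan : ⊤ ≤ Submodule.span ℚ_[p] (Set.range (fun i : Fin d => e i)) :=
    (hli.span_eq_top_of_card_eq_finrank' (by simp [hfr])).ge
  let _ : Algebra ℤ_[p] L := ((algebraMap ℚ_[p] L).comp (algebraMap ℤ_[p] ℚ_[p])).toAlgebra
  have halg : ∀ (c : ℤ_[p]) (x : L), c • x = algebraMap ℚ_[p] L c * x := fun c x => rfl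
  -- e lies in the ℤ_p-span of f
  have hef : ∀ k, k ≤ d → ∀ i, 1 ≤ i → i + k = d →
      e i ∈ Submodule.span ℤ_[p] (Set.range f) := by
    have h0 : e 0 ∈ Submodule.span ℤ_[p] (Set.range f) := by
      rw [← hf0 z rfl]; exact Submodule.subset_span ⟨z, rfl⟩
    intro k
    induction k with
    | zero =>
      intro _ i _ hi
      obtain rfl : i = d := by omega
      rw [hper]; exact h0
    | succ k ih =>
      intro hk i h1 hi
      have h2 := ih (by omega) (i + 1) (by omega) (by omega)
      have h3 : f ⟨i, by omega⟩ ∈ Submodule.span ℤ_[p] (Set.range f) :=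
        Submodule.subset_span ⟨_, rfl⟩
      rw [hf ⟨i, by omega⟩ (by simp; omega)] at h3
      simpa using Submodule.add_mem _ h3 h2
  have hef' : ∀ i : Fin d, e i ∈ Submodule.span ℤ_[p] (Set.range f) := by
    intro i
    by_cases hi : (i : ℕ) = 0
    · rw [hi, ← hf0 z rfl]; exact Submodule.subset_span ⟨z, rfl⟩
    · exact hef (d - i) (by omega) i (by omega) (by omega)
  have hexf : ∀ x : L, abv x ≤ 1 →
      ∃ c : Fin d → ℤ_[p], x = ∑ i : Fin d, algebraMap ℚ_[p] L (c i) * f i := by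
    intro x hx
    obtain ⟨a, ha⟩ := (Submodule.mem_span_range_iff_exists_fun ℚ_[p]).mp
      (hspan (Submodule.mem_top (x := x)))
    simp only [Algebra.smul_def] at ha
    have hale : ∀ i, ‖a i‖ ≤ 1 := fun i =>
      (coeff_le p abv habv _ hnb a i).trans (by rw [ha]; exact hx)
    have hmem : x ∈ Submodule.span ℤ_[p] (Set.range f) := by
      rw [← ha]
      refine Submodule.sum_mem _ fun i _ => ?_
      let b : ℤ_[p] := ⟨a i, hale i⟩
      exact Submodule.smul_mem _ b (hef' i)
    obtain ⟨c, hc⟩ := (Submodule.mem_span_range_iff_exists_fun ℤ_[p]).mp hmem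
    exact ⟨c, by simp only [halg] at hc; exact hc.symm⟩
  -- f is linearly independent over ℚ_p
  have hlif : LinearIndependent ℚ_[p] f := by
    refine linearIndependent_of_top_le_span_of_card_eq_finrank ?_ (by simp [hfr])
    refine hspan.trans (Submodule.span_le.mpr ?_)
    rintro _ ⟨i, rfl⟩
    obtain ⟨c, hc⟩ := (Submodule.mem_span_range_iff_exists_fun ℤ_[p]).mp (hef' i)
    simp only [SetLike.mem_coe]
    rw [← hc]
    refine Submodule.sum_mem _ fun j _ => ?_
    rw [halg, ← Algebra.smul_def]
    exact Submodule.smul_mem _ _ (Submodule.subset_span ⟨j, rfl⟩)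
  have huf : ∀ c c' : Fin d → ℤ_[p], ∑ i : Fin d, algebraMap ℚ_[p] L (c i) * f i =
      ∑ i : Fin d, algebraMap ℚ_[p] L (c' i) * f i → c = c' := by
    intro c c' h
    have h1 := Fintype.linearIndependent_iff.mp hlif (fun i => (c i : ℚ_[p]) - c' i) (by
      simp only [Algebra.smul_def, map_sub, sub_mul, Finset.sum_sub_distrib]
      exact sub_eq_zero.mpr h)
    funext i
    exact PadicInt.ext (sub_eq_zero.mp (h1 i))
  -- g-combinations as f-combinations
  have hgf : ∀ c : Fin d → ℤ_[p], ∑ i : Fin d, algebraMap ℚ_[p] L (c i) * g i =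
      ∑ i : Fin d, algebraMap ℚ_[p] L ((if (i : ℕ) = 0 then (p : ℤ_[p]) * c i else c i : ℤ_[p])) *
        f i := by
    intro c
    refine Finset.sum_congr rfl fun i _ => ?_
    by_cases hi : (i : ℕ) = 0
    · rw [hg0 i hi, if_pos hi, PadicInt.coe_mul, map_mul, PadicInt.coe_natCast, map_natCast]
      ring
    · rw [hg i hi, if_neg hi]
  -- traces
  set T : ℚ_[p] := Algebra.trace ℚ_[p] L (e 0) with hT
  have hTe : ∀ i, Algebra.trace ℚ_[p] L (e i) = T := fun i =>
    (algebraMap ℚ_[p] L).injective (by rw [htr, hT, htr])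
  have hT1 : 1 ≤ ‖T‖ := by
    by_contra! hlt
    have := hnb (fun _ => 1) (by
      simp only [PadicInt.coe_one, map_one, one_mul]
      rw [← htr 0, habv]; exact hlt) z
    simp at this
  have hT2 : ‖T‖ ≤ 1 := by
    rw [← habv, hT, htr]
    have := abv_sum_le p abv hna habv (fun i : Fin d => e i) (fun i => he i) (fun _ => 1)
    simpa using this
  have hTn : ‖T‖ = 1 := le_antisymm hT2 hT1
  have htrf : ∀ c : Fin d → ℤ_[p],
      Algebra.trace ℚ_[p] L (∑ i : Fin d, algebraMap ℚ_[p] L (c i) * f i) = c z * T := by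
    intro c
    rw [map_sum, Finset.sum_eq_single z]
    · rw [← Algebra.smul_def, map_smul, hf0 z rfl, smul_eq_mul]
    · intro i _ hi
      have hi' : (i : ℕ) ≠ 0 := fun h => hi ((hz i).mp h)
      rw [← Algebra.smul_def, map_smul, hf i hi', map_sub, hTe, hTe, sub_self, smul_zero]
    · intro h; exact absurd (Finset.mem_univ z) h
  refine ⟨⟨abv_sum_le p abv hna habv f hfle, ?_⟩, ?_, ?_⟩
  · intro x hx
    obtain ⟨c, hc⟩ := hexf x hx
    exact ⟨c, hc, fun c' hc' => huf _ _ (hc'.symm.trans hc)⟩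
  · intro c
    rw [hgf]
    refine ⟨abv_sum_le p abv hna habv f hfle _, ?_⟩
    rw [htrf, norm_mul, hTn, mul_one, if_pos rfl, PadicInt.coe_mul, norm_mul, PadicInt.coe_natCast,
      Padic.norm_p]
    exact mul_le_of_le_one_right (by positivity) (c z).norm_le_one
  · intro x hx hxt
    obtain ⟨c, hc⟩ := hexf x hx
    have h1 : ‖(c z : ℚ_[p])‖ ≤ (p : ℝ)⁻¹ := by
      rw [hc, htrf, norm_mul, hTn, mul_one] at hxt; exact hxt
    obtain ⟨b, hb⟩ : (p : ℤ_[p]) ∣ c z := by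
      rw [← PadicInt.norm_lt_one_iff_dvd]
      refine lt_of_le_of_lt h1 (inv_lt_one_of_one_lt₀ ?_)
      exact_mod_cast (Fact.out : p.Prime).one_lt
    refine ⟨fun i => if (i : ℕ) = 0 then b else c i, ?_, ?_⟩
    · beta_reduce
      rw [hgf, hc]
      refine Finset.sum_congr rfl fun i _ => ?_
      by_cases hi : (i : ℕ) = 0
      · rw [if_pos hi, if_pos hi, (hz i).mp hi, hb]
      · rw [if_neg hi, if_neg hi]
    · intro c' hc'
      beta_reduce at hc'
      rw [hgf, hc] at hc'
      have h2 := huf _ _ hc'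
      funext i
      have h3 := congrFun h2 i
      by_cases hi : (i : ℕ) = 0
      · rw [if_pos hi] at h3 ⊢
        rw [(hz i).mp hi, hb] at h3
        rw [(hz i).mp hi]
        exact (mul_left_cancel₀ (by exact_mod_cast (Fact.out : p.Prime).ne_zero) h3).symm
      · rw [if_neg hi] at h3 ⊢
        exact h3.symm

theorem Kur_splitting (p : ℕ) [Fact p.Prime] {d : ℕ} (hd : 0 < d) :
    (X ^ (p ^ d - 1) - 1 : ℚ_[p][X]).IsSplittingField ℚ_[p] (Kur p d) := by
  have hp1 : 1 < p ^ d := Nat.one_lt_pow hd.ne' (Fact.out : p.Prime).one_lt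
  have hne : (X ^ (p ^ d - 1) - 1 : ℚ_[p][X]) ≠ 0 := by
    simpa using X_pow_sub_C_ne_zero (R := ℚ_[p]) (n := p ^ d - 1) (by omega) 1
  have : Kur p d = IntermediateField.adjoin ℚ_[p]
      ((X ^ (p ^ d - 1) - 1 : ℚ_[p][X]).rootSet (Qpbar p)) := by
    unfold Kur
    congr 1
    ext x
    rw [mem_rootSet]
    simp [hne, sub_eq_zero]
  rw [this]
  exact IntermediateField.adjoin_rootSet_isSplittingField (IsAlgClosed.splits _)

theorem Kur_gen (p : ℕ) [Fact p.Prime] (d : ℕ) :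
    IntermediateField.adjoin ℚ_[p] {x : Kur p d | x ^ (p ^ d - 1) = 1} = ⊤ := by
  apply IntermediateField.lift_injective
  rw [IntermediateField.lift_adjoin, IntermediateField.lift_top]
  conv_rhs => unfold Kur
  congr 1
  ext x
  constructor
  · rintro ⟨y, hy, rfl⟩
    have := congrArg Subtype.val hy
    exact this
  · intro hx
    refine ⟨⟨x, IntermediateField.subset_adjoin _ _ hx⟩, ?_, rfl⟩
    exact Subtype.ext hx

/-- let `η ∈ μ_{q-1}` be such that `η̄, η̄^p, …, η̄^{p^{d-1}}` is an
`𝔽_p`-basis of the residue field `k` (a normal basis; this is the hypothesis `hηnb`: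
any `ℤ_p`-combination of `η, η^p, …, η^{p^{d-1}}` lying in `P_K` has all coefficients in
`p ℤ_p`).  Then every element of `O_K = {x ∈ K : |x| ≤ 1}` is, in a unique way, a
`ℤ_p`-linear combination of `η` and the `η^{p^i} - η^{p^{i+1}}` (`1 ≤ i ≤ d-1`), and
conversely all such combinations lie in `O_K`; and every element of
`Z = {x ∈ O_K : Tr_{K/ℚ_p}(x) ∈ p ℤ_p}` is, in a unique way, a `ℤ_p`-linear combination
of `p η` and the `η^{p^i} - η^{p^{i+1}}` (`1 ≤ i ≤ d-1`), and conversely. -/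
theorem statement11 (hp : Odd p) (d : ℕ) (hd : 0 < d)
    (abv : AbsoluteValue (Qpbar p) ℝ)
    (habv : ∀ x : ℚ_[p], abv (algebraMap ℚ_[p] (Qpbar p) x) = ‖x‖)
    (η : Kur p d) (hη : (η : Qpbar p) ^ (p ^ d - 1) = 1)
    (hηnb : ∀ c : Fin d → ℤ_[p],
      abv ↑(∑ i : Fin d, zpToK p d (c i) * η ^ p ^ (i : ℕ)) < 1 → ∀ i, ‖c i‖ < 1) :
    ((∀ c : Fin d → ℤ_[p],
        abv ↑(∑ i : Fin d, zpToK p d (c i) *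
          (if (i : ℕ) = 0 then η else η ^ p ^ (i : ℕ) - η ^ p ^ ((i : ℕ) + 1))) ≤ 1) ∧
      (∀ x : Kur p d, abv ↑x ≤ 1 →
        ∃! c : Fin d → ℤ_[p],
          x = ∑ i : Fin d, zpToK p d (c i) *
            (if (i : ℕ) = 0 then η else η ^ p ^ (i : ℕ) - η ^ p ^ ((i : ℕ) + 1)))) ∧
    ((∀ c : Fin d → ℤ_[p],
        abv ↑(∑ i : Fin d, zpToK p d (c i) *
          (if (i : ℕ) = 0 then (p : Kur p d) * η
            else η ^ p ^ (i : ℕ) - η ^ p ^ ((i : ℕ) + 1))) ≤ 1 ∧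
        ‖Algebra.trace ℚ_[p] (Kur p d)
          (∑ i : Fin d, zpToK p d (c i) *
            (if (i : ℕ) = 0 then (p : Kur p d) * η
              else η ^ p ^ (i : ℕ) - η ^ p ^ ((i : ℕ) + 1)))‖ ≤ (p : ℝ)⁻¹) ∧
      (∀ x : Kur p d, abv ↑x ≤ 1 →
        ‖Algebra.trace ℚ_[p] (Kur p d) x‖ ≤ (p : ℝ)⁻¹ →
        ∃! c : Fin d → ℤ_[p],
          x = ∑ i : Fin d, zpToK p d (c i) *
            (if (i : ℕ) = 0 then (p : Kur p d) * η
              else η ^ p ^ (i : ℕ) - η ^ p ^ ((i : ℕ) + 1)))) := by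
  have hsplit := Kur_splitting p hd
  have hfin : FiniteDimensional ℚ_[p] (Kur p d) :=
    IsSplittingField.finiteDimensional _ (X ^ (p ^ d - 1) - 1 : ℚ_[p][X])
  have hnor : Normal ℚ_[p] (Kur p d) :=
    Normal.of_isSplittingField (X ^ (p ^ d - 1) - 1 : ℚ_[p][X])
  have hgal : IsGalois ℚ_[p] (Kur p d) := { }
  let w : AbsoluteValue (Kur p d) ℝ :=
    abv.comp (f := algebraMap (Kur p d) (Qpbar p)) (algebraMap (Kur p d) (Qpbar p)).injective
  have hw : ∀ x : ℚ_[p], w (algebraMap ℚ_[p] (Kur p d) x) = ‖x‖ := habv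
  have hη' : η ^ (p ^ d - 1) = 1 := Subtype.ext hη
  have hwna := abv_na p w hw
  have hn0 : p ^ d - 1 ≠ 0 := by
    have := Nat.one_lt_pow hd.ne' (Fact.out : p.Prime).one_lt
    omega
  have hη1 : w η = 1 := by
    have h1 : w η ^ (p ^ d - 1) = 1 := by rw [← map_pow, hη', map_one]
    exact (pow_eq_one_iff_of_nonneg (w.nonneg η) hn0).mp h1
  obtain ⟨hfr, htr⟩ := gal_main p hd (Kur_gen p d) w hw η hη' hηnb
  exact lin_main p hd hfr w hwna hw (fun i => η ^ p ^ i)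
    (by simp only [pow_zero, pow_one]; exact pow_q hη')
    (fun i => by simp only [map_pow, hη1, one_pow, le_refl]) hηnb htr _ _
    (fun i hi => by rw [if_pos hi, pow_zero, pow_one])
    (fun i hi => by rw [if_neg hi])
    (fun i hi => by rw [if_pos hi, if_pos hi])
    (fun i hi => by rw [if_neg hi, if_neg hi])
end
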